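/- Let n ∈ ℕ, E a complex Banach space, s ∈ ℝ, 0 < p ≤ ∞, 0 < q ≤ ∞, and let S ∈ ℤ with S ≥ −1 and S ≥ ⌊s⌋. Let ε > 0 and Ψ, ψ ∈ S(ℝ^n) satisfy |Ψ(x)| > 0 for |x| < 2ε, |ψ(x)| > 0 for ε/2 < |x| < 2ε, and D^α ψ(0) = 0 for all multi-indices |α| ≤ S. Then there exist constants c₁, c₂ > 0 such that for all f ∈ B^s_{p,q}(E): c₁ ‖f|B^s_{p,q}(E)‖ ≤ ‖(Ψ f̂)ˇ|L_p(E)‖ + (Σ_{j≥1} 2^{jsq} ‖(ψ(2^{−j}·) f̂)ˇ|L_p(E)‖^q)^{1/q} ≤ c₂ ‖f|B^s_{p,q}(E)‖ (supremum over j if q = ∞). Moreover, an f ∈ S'(ℝ^n,E) belongs to B^s_{p,q}(E) if and only if ‖(Ψ f̂)ˇ|L_p(E)‖ + (Σ_{j≥1} 2^{jsq} ‖(ψ(2^{−j}·) f̂)ˇ|L_p(E)‖^q)^{1/q} < ∞. -/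

import Mathlib

noncomputable section

open MeasureTheory Filter Metric Real Set SchwartzMap
open scoped ENNReal NNReal Topology FourierTransform

/-- Euclidean space ℝⁿ. -/
abbrev Rn (n : ℕ) : Type := EuclideanSpace ℝ (Fin n)

/-- The Schwartz space 𝓢(ℝⁿ, ℂ). -/
abbrev Sch (n : ℕ) : Type := SchwartzMap (Rn n) ℂ

/-- Partial derivative in the `i`-th coordinate direction. -/
def pd {F : Type*} [NormedAddCommGroup F] [NormedSpace ℝ F] {n : ℕ} (i : Fin n)
    (g : Rn n → F) : Rn n → F :=
  fun x => lineDeriv ℝ g x (EuclideanSpace.single i (1 : ℝ))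

/-- Multi-index derivative `D^α = ∂₁^{α₁} ⋯ ∂ₙ^{αₙ}`. -/
def mderiv {F : Type*} [NormedAddCommGroup F] [NormedSpace ℝ F] {n : ℕ} (α : Fin n → ℕ)
    (g : Rn n → F) : Rn n → F :=
  (List.finRange n).foldr (fun i h => (pd i)^[α i] h) g

/-- The order `|α|` of a multi-index. -/
def mdeg {n : ℕ} (α : Fin n → ℕ) : ℕ := ∑ i, α i

/-- The Schwartz seminorm `‖φ‖_{K,L} = sup_x (1+|x|²)^{K/2} ∑_{|α| ≤ L} |D^α φ(x)|`. -/
def schSemi {n : ℕ} (K L : ℕ) (φ : Sch n) : ℝ :=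
  ⨆ x : Rn n, (1 + ‖x‖ ^ 2) ^ ((K : ℝ) / 2) *
    ∑ α : Fin n → Fin (L + 1), if mdeg (fun i => (α i : ℕ)) ≤ L
      then ‖mderiv (fun i => (α i : ℕ)) (fun y => φ y) x‖ else 0

/-- `E`-valued tempered distributions: linear maps `𝓢(ℝⁿ) → E` bounded by some
Schwartz seminorm. -/
structure TDist (n : ℕ) (E : Type*) [NormedAddCommGroup E] [NormedSpace ℂ E] where
  toFun : Sch n →ₗ[ℂ] E
  bound : ∃ (c : ℝ) (K L : ℕ), ∀ φ : Sch n, ‖toFun φ‖ ≤ c * schSemi K L φ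

namespace Aux

lemma hasTemperateGrowth_sub_left {n : ℕ} (x : Rn n) :
    Function.HasTemperateGrowth (fun y : Rn n => x - y) := by
  apply Function.HasTemperateGrowth.of_fderiv (k := 1) (C := ‖x‖ + 1)
  · have h : (fderiv ℝ (fun y : Rn n => x - y)) =
        fun _ : Rn n => -(ContinuousLinearMap.id ℝ (Rn n)) := by
      ext1 y
      rw [fderiv_const_sub]
      simp
    rw [h]
    exact .const _
  · exact (differentiable_const x).sub differentiable_id
  · intro y
    have h1 : ‖x - y‖ ≤ ‖x‖ + ‖y‖ := norm_sub_le x y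
    have h2 : (0:ℝ) ≤ ‖y‖ := norm_nonneg y
    have h3 : (0:ℝ) ≤ ‖x‖ := norm_nonneg x
    calc ‖x - y‖ ≤ ‖x‖ + ‖y‖ := h1
      _ ≤ (‖x‖ + 1) * (1 + ‖y‖) ^ 1 := by nlinarith

lemma antilipschitz_sub_left {n : ℕ} (x : Rn n) :
    AntilipschitzWith 1 (fun y : Rn n => x - y) := by
  refine (Isometry.antilipschitz ?_)
  intro y z
  simp only [edist_dist, dist_eq_norm, sub_sub_sub_cancel_left, norm_sub_rev]

end Aux

/-- The Schwartz function `y ↦ ψ(x - y)`. -/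
def shiftReflect {n : ℕ} (ψ : Sch n) (x : Rn n) : Sch n :=
  SchwartzMap.compCLMOfAntilipschitz (𝕜 := ℝ)
    (Aux.hasTemperateGrowth_sub_left x) (Aux.antilipschitz_sub_left x) ψ

/-- The dilated Schwartz function `ψ(t ·)` (junk value `0` when `t = 0`). -/
def dilate {n : ℕ} (ψ : Sch n) (t : ℝ) : Sch n :=
  if h : t = 0 then 0 else
    SchwartzMap.compCLM (𝕜 := ℝ) (g := fun y : Rn n => t • y)
      (by
        have := (t • ContinuousLinearMap.id ℝ (Rn n)).hasTemperateGrowth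
        exact this)
      (⟨1, |t|⁻¹, fun y => by
        have ht : 0 < |t| := abs_pos.mpr h
        have : ‖t • y‖ = |t| * ‖y‖ := by rw [norm_smul]; simp [Real.norm_eq_abs]
        rw [pow_one, this]
        rw [mul_add, mul_one]
        have : |t|⁻¹ * (|t| * ‖y‖) = ‖y‖ := by field_simp
        nlinarith [norm_nonneg y, inv_pos.mpr ht]⟩) ψ

/-- Fourier transform on Schwartz space. -/
def fourierS {n : ℕ} (φ : Sch n) : Sch n := FourierTransform.fourierCLE ℂ (Sch n) φ

/-- Inverse Fourier transform on Schwartz space. -/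
def invFourierS {n : ℕ} (φ : Sch n) : Sch n := (FourierTransform.fourierCLE ℂ (Sch n)).symm φ

variable {n : ℕ} {E : Type*} [NormedAddCommGroup E] [NormedSpace ℂ E]

/-- Convolution `(ψ * f)(x) := (2π)^{-n/2} f(ψ(x - ·))` of a Schwartz function with an
`E`-valued tempered distribution. -/
def tdConv (ψ : Sch n) (f : TDist n E) : Rn n → E :=
  fun x => ((2 * π) ^ (-(n : ℝ) / 2) : ℝ) • f.toFun (shiftReflect ψ x)

/-- The operator `f ↦ (φ f̂)ˇ = φ̌ * f`. -/
def mOp (φ : Sch n) (f : TDist n E) : Rn n → E := tdConv (invFourierS φ) f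

/-- `L_p`-norm (in `[0,∞]`) of an `ℝ≥0∞`-valued function. -/
def lpNormENN {n : ℕ} (p : ℝ≥0∞) (g : Rn n → ℝ≥0∞) : ℝ≥0∞ :=
  if p = ∞ then essSup g volume else (∫⁻ x, (g x) ^ p.toReal) ^ (1 / p.toReal)

/-- `ℓ_q`-norm (in `[0,∞]`) of a sequence, with the usual modification for `q = ∞`. -/
def lqSum (q : ℝ≥0∞) (a : ℕ → ℝ≥0∞) : ℝ≥0∞ :=
  if q = ∞ then ⨆ j, a j else (∑' j, (a j) ^ q.toReal) ^ (1 / q.toReal)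

/-- A smooth dyadic resolution of unity. -/
structure SmoothResolution (n : ℕ) (φ : ℕ → Sch n) : Prop where
  supp0 : Function.support (φ 0) ⊆ {ξ : Rn n | ‖ξ‖ ≤ 2}
  suppj : ∀ j : ℕ, 0 < j →
    Function.support (φ j) ⊆ {ξ : Rn n | 2 ^ ((j : ℝ) - 1) ≤ ‖ξ‖ ∧ ‖ξ‖ ≤ 2 ^ ((j : ℝ) + 1)}
  sum_eq : ∀ ξ : Rn n, ∑' j : ℕ, φ j ξ = 1
  deriv_bound : ∀ α : Fin n → ℕ, ∃ c : ℝ, ∀ (j : ℕ) (ξ : Rn n),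
    ‖mderiv α (fun y => φ j y) ξ‖ ≤ c * 2 ^ (-(j : ℝ) * (mdeg α : ℝ))

/-- The Besov quasi-norm `‖f | B^s_{p,q}(E)‖` w.r.t. the resolution of unity `φ`. -/
def besovNorm (s : ℝ) (p q : ℝ≥0∞) (φ : ℕ → Sch n) (f : TDist n E) : ℝ≥0∞ :=
  lqSum q fun j => (2 : ℝ≥0∞) ^ ((j : ℝ) * s) * eLpNorm (mOp (φ j) f) p volume

/-- The Triebel–Lizorkin quasi-norm `‖f | F^s_{p,q}(E)‖` w.r.t. the resolution of unity `φ`. -/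
def triebelNorm (s : ℝ) (p q : ℝ≥0∞) (φ : ℕ → Sch n) (f : TDist n E) : ℝ≥0∞ :=
  lpNormENN p fun x =>
    lqSum q fun j => (2 : ℝ≥0∞) ^ ((j : ℝ) * s) * (‖mOp (φ j) f x‖₊ : ℝ≥0∞)

variable {n : ℕ} {E : Type*} [NormedAddCommGroup E] [NormedSpace ℂ E]

/-- `‖(Ψ f̂)ˇ|L_p(E)‖ + (∑_{j≥1} 2^{jsq} ‖(ψ(2^{-j}·) f̂)ˇ|L_p(E)‖^q)^{1/q}`. -/
def besovPsiNorm (s : ℝ) (p q : ℝ≥0∞) (Ψ ψ : Sch n) (f : TDist n E) : ℝ≥0∞ :=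
  eLpNorm (mOp Ψ f) p volume +
    lqSum q fun j => (2 : ℝ≥0∞) ^ (((j : ℝ) + 1) * s) *
      eLpNorm (mOp (dilate ψ ((2 : ℝ) ^ (-((j : ℝ) + 1)))) f) p volume

/-- `‖(Ψ f̂)ˇ|L_p(E)‖ + ‖(∑_{j≥1} 2^{jsq} ‖(ψ(2^{-j}·) f̂)ˇ(·)‖_E^q)^{1/q}|L_p‖`. -/
def triebelPsiNorm (s : ℝ) (p q : ℝ≥0∞) (Ψ ψ : Sch n) (f : TDist n E) : ℝ≥0∞ :=
  eLpNorm (mOp Ψ f) p volume +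
    lpNormENN p fun x => lqSum q fun j => (2 : ℝ≥0∞) ^ (((j : ℝ) + 1) * s) *
      (‖mOp (dilate ψ ((2 : ℝ) ^ (-((j : ℝ) + 1)))) f x‖₊ : ℝ≥0∞)

namespace Aux

lemma eLpNorm_tsum_le' {α : Type*} [MeasurableSpace α] {μ : Measure α} {u : ℝ≥0∞} (hu : 1 ≤ u)
    {h : ℕ → α → ℝ≥0∞} (hm : ∀ i, Measurable (h i)) :
    eLpNorm (fun x => ∑' i, h i x) u μ ≤ ∑' i, eLpNorm (h i) u μ := by
  have hfin : ∀ m : ℕ, eLpNorm (fun x => ∑ i ∈ Finset.range m, h i x) u μ ≤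
      ∑' i, eLpNorm (h i) u μ := by
    intro m
    have := eLpNorm_sum_le (f := h) (s := Finset.range m) (p := u) (μ := μ)
      (fun i _ => (hm i).aestronglyMeasurable) hu
    have e : (∑ i ∈ Finset.range m, h i) = (fun x => ∑ i ∈ Finset.range m, h i x) := by
      ext x; simp
    rw [e] at this
    exact this.trans (ENNReal.sum_le_tsum _)
  have hmono : Monotone fun (m : ℕ) x => ∑ i ∈ Finset.range m, h i x := by
    intro a b hab x
    exact Finset.sum_le_sum_of_subset (Finset.range_mono hab)
  by_cases htop : u = ∞
  · subst htop
    simp only [eLpNorm_exponent_top] at hfin ⊢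
    refine essSup_le_of_ae_le _ ?_
    have h1 : ∀ᵐ x ∂μ, ∀ m : ℕ, ∑ i ∈ Finset.range m, h i x ≤
        ∑' i, eLpNormEssSup (h i) μ := by
      rw [ae_all_iff]
      intro m
      filter_upwards [ENNReal.ae_le_essSup (μ := μ) (fun x => ∑ i ∈ Finset.range m, h i x)] with x hx
      refine hx.trans ?_
      have := hfin m
      simpa [eLpNormEssSup] using this
    filter_upwards [h1] with x hx
    simp only [enorm_eq_self]
    rw [ENNReal.tsum_eq_iSup_nat]
    exact iSup_le hx
  · have hu0 : u ≠ 0 := by intro h0; simp [h0] at hu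
    have hup : 0 < u.toReal := ENNReal.toReal_pos hu0 htop
    rw [eLpNorm_eq_lintegral_rpow_enorm_toReal hu0 htop]
    simp only [enorm_eq_self]
    have e : ∀ x, (∑' i, h i x) ^ u.toReal = ⨆ m : ℕ, (∑ i ∈ Finset.range m, h i x) ^ u.toReal := by
      intro x
      rw [ENNReal.tsum_eq_iSup_nat]
      exact (ENNReal.orderIsoRpow u.toReal hup).map_iSup _
    simp_rw [e]
    rw [lintegral_iSup]
    · rw [one_div, ENNReal.rpow_inv_le_iff hup]
      apply iSup_le
      intro m
      have := hfin m
      rw [eLpNorm_eq_lintegral_rpow_enorm_toReal hu0 htop] at this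
      simp only [enorm_eq_self] at this
      rwa [one_div, ENNReal.rpow_inv_le_iff hup] at this
    · intro m
      exact (Finset.measurable_sum _ fun i _ => hm i).pow_const _
    · intro a b hab x
      exact ENNReal.rpow_le_rpow (hmono hab x) hup.le

lemma jensen_rpow {α : Type*} [MeasurableSpace α] {ρ : Measure α} {u : ℝ} (hu : 1 ≤ u)
    {g : α → ℝ≥0∞} (hg : Measurable g) :
    (∫⁻ y, g y ∂ρ) ^ u ≤ (∫⁻ y, g y ^ u ∂ρ) * ρ univ ^ (u - 1) := by
  have h := eLpNorm'_le_eLpNorm'_mul_rpow_measure_univ (f := g) (μ := ρ) one_pos hu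
    hg.aestronglyMeasurable
  have hu0 : 0 < u := by linarith
  simp only [eLpNorm', enorm_eq_self, ENNReal.rpow_one, one_div, inv_one] at h
  have h2 := ENNReal.rpow_le_rpow h hu0.le
  rw [ENNReal.mul_rpow_of_nonneg _ _ hu0.le, ← ENNReal.rpow_mul, ← ENNReal.rpow_mul,
    inv_mul_cancel₀ hu0.ne', ENNReal.rpow_one] at h2
  have e : (1 - u⁻¹) * u = u - 1 := by field_simp
  rwa [e] at h2

lemma schur {α β : Type*} [MeasurableSpace α] [MeasurableSpace β] {μ : Measure α} {ν : Measure β}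
    [SFinite μ] [SFinite ν] {u : ℝ≥0∞} (hu : 1 ≤ u) {K : α → β → ℝ≥0∞}
    (hK : Measurable (Function.uncurry K)) {A : ℝ≥0∞}
    (h1 : ∀ x, ∫⁻ y, K x y ∂ν ≤ A) (h2 : ∀ y, ∫⁻ x, K x y ∂μ ≤ A) {g : β → ℝ≥0∞}
    (hg : Measurable g) :
    eLpNorm (fun x => ∫⁻ y, K x y * g y ∂ν) u μ ≤ A * eLpNorm g u ν := by
  have hKx : ∀ x, Measurable (K x) := fun x => hK.comp measurable_prodMk_left
  by_cases htop : u = ∞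
  · subst htop
    simp only [eLpNorm_exponent_top]
    refine essSup_le_of_ae_le _ ?_
    filter_upwards with x
    simp only [enorm_eq_self]
    calc ∫⁻ y, K x y * g y ∂ν ≤ ∫⁻ y, K x y * eLpNormEssSup g ν ∂ν := by
          apply lintegral_mono_ae
          filter_upwards [ENNReal.ae_le_essSup (μ := ν) g] with y hy
          gcongr
          simpa [eLpNormEssSup] using hy
      _ = (∫⁻ y, K x y ∂ν) * eLpNormEssSup g ν := lintegral_mul_const _ (hKx x)
      _ ≤ _ := by gcongr; exact h1 x
  · have hu0 : u ≠ 0 := by intro h0; simp [h0] at hu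
    have hup : 0 < u.toReal := ENNReal.toReal_pos hu0 htop
    have hu1 : 1 ≤ u.toReal := by
      have := (ENNReal.toReal_le_toReal ENNReal.one_ne_top htop).2 hu
      simpa using this
    rw [eLpNorm_eq_lintegral_rpow_enorm_toReal hu0 htop,
      eLpNorm_eq_lintegral_rpow_enorm_toReal hu0 htop]
    simp only [enorm_eq_self]
    set t := u.toReal
    have key : ∀ x, (∫⁻ y, K x y * g y ∂ν) ^ t ≤ (∫⁻ y, K x y * g y ^ t ∂ν) * A ^ (t - 1) := by
      intro x
      have := jensen_rpow (ρ := ν.withDensity (K x)) hu1 hg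
      rw [lintegral_withDensity_eq_lintegral_mul _ (hKx x) hg,
        lintegral_withDensity_eq_lintegral_mul _ (hKx x) (hg.pow_const _),
        withDensity_apply _ MeasurableSet.univ, setLIntegral_univ] at this
      refine this.trans ?_
      gcongr
      · simp
      · exact h1 x
    rw [one_div, ENNReal.rpow_inv_le_iff hup, ENNReal.mul_rpow_of_nonneg _ _ hup.le,
      ENNReal.rpow_inv_rpow hup.ne']
    have hmm : Measurable (Function.uncurry fun x y => K x y * g y ^ t) :=
      hK.mul ((hg.comp measurable_snd).pow_const _)
    calc ∫⁻ x, (∫⁻ y, K x y * g y ∂ν) ^ t ∂μ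
        ≤ ∫⁻ x, (∫⁻ y, K x y * g y ^ t ∂ν) * A ^ (t - 1) ∂μ := lintegral_mono key
      _ = (∫⁻ x, ∫⁻ y, K x y * g y ^ t ∂ν ∂μ) * A ^ (t - 1) :=
          lintegral_mul_const _ hmm.lintegral_prod_right
      _ = (∫⁻ y, ∫⁻ x, K x y * g y ^ t ∂μ ∂ν) * A ^ (t - 1) := by
          rw [lintegral_lintegral_swap hmm.aemeasurable]
      _ ≤ (∫⁻ y, A * g y ^ t ∂ν) * A ^ (t - 1) := by
          gcongr with y
          have hKy : Measurable fun x => K x y := hK.comp measurable_prodMk_right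
          rw [lintegral_mul_const _ hKy]
          gcongr
          exact h2 y
      _ = A ^ t * ∫⁻ y, g y ^ t ∂ν := by
          rw [lintegral_const_mul _ (hg.pow_const _)]
          have : A ^ t = A * A ^ (t - 1) := by
            conv_rhs => enter [1]; rw [← ENNReal.rpow_one A]
            rw [← ENNReal.rpow_add_of_nonneg _ _ zero_le_one (by linarith)]
            congr 1; ring
          rw [this]; ring

lemma lqSum_eq (q : ℝ≥0∞) (hq : 0 < q) (a : ℕ → ℝ≥0∞) :
    lqSum q a = eLpNorm a q Measure.count := by
  unfold lqSum
  split_ifs with h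
  · subst h
    simp only [eLpNorm_exponent_top, eLpNormEssSup, enorm_eq_self]
    exact (essSup_eq_iSup (by intro x; simp) _).symm
  · rw [eLpNorm_eq_lintegral_rpow_enorm_toReal hq.ne' h, lintegral_count]
    simp

lemma tsum_rpow_le {r : ℝ} (hr : 0 < r) (hr1 : r ≤ 1) (a : ℕ → ℝ≥0∞) :
    (∑' i, a i) ^ r ≤ ∑' i, a i ^ r := by
  have hfin : ∀ m : ℕ, (∑ i ∈ Finset.range m, a i) ^ r ≤ ∑ i ∈ Finset.range m, a i ^ r := by
    intro m
    induction m with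
    | zero => simp [hr]
    | succ m ih =>
      rw [Finset.sum_range_succ, Finset.sum_range_succ]
      exact (ENNReal.rpow_add_le_add_rpow _ _ hr.le hr1).trans (by gcongr)
  rw [ENNReal.tsum_eq_iSup_nat]
  have : (⨆ m : ℕ, ∑ i ∈ Finset.range m, a i) ^ r = ⨆ m : ℕ, (∑ i ∈ Finset.range m, a i) ^ r :=
    (ENNReal.orderIsoRpow r hr).map_iSup _
  rw [this]
  exact iSup_le fun m => (hfin m).trans (ENNReal.sum_le_tsum _)

end Aux

namespace Aux

/-- powers of two in `ℝ≥0∞`. -/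
def e2 (t : ℝ) : ℝ≥0∞ := (2 : ℝ≥0∞) ^ t

lemma e2_add (a b : ℝ) : e2 (a + b) = e2 a * e2 b :=
  ENNReal.rpow_add _ _ (by norm_num) (by norm_num)

lemma e2_rpow (a r : ℝ) : e2 a ^ r = e2 (a * r) := (ENNReal.rpow_mul _ _ _).symm

lemma e2_ne_top (a : ℝ) : e2 a ≠ ∞ := ENNReal.rpow_ne_top_of_ne_zero (by norm_num) (by norm_num)

lemma e2_ne_zero (a : ℝ) : e2 a ≠ 0 := by simp [e2]

lemma e2_mono {a b : ℝ} (h : a ≤ b) : e2 a ≤ e2 b :=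
  ENNReal.rpow_le_rpow_of_exponent_le (by norm_num) h

lemma e2_zero : e2 0 = 1 := by simp [e2]

lemma e2_ofReal (a : ℝ) : e2 a = ENNReal.ofReal ((2 : ℝ) ^ a) := by
  rw [e2, ← ENNReal.ofReal_rpow_of_pos (by norm_num)]; simp

/-- The basic decay factor `1 / (2^d (1 + 2^k |y|))`. -/
def V {n : ℕ} (k d : ℕ) (y : Rn n) : ℝ≥0∞ :=
  (ENNReal.ofReal ((2 : ℝ) ^ d * (1 + 2 ^ k * ‖y‖)))⁻¹

lemma V_pos_real {n : ℕ} (k d : ℕ) (y : Rn n) : 1 ≤ (2 : ℝ) ^ d * (1 + 2 ^ k * ‖y‖) := by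
  have h1 : (1 : ℝ) ≤ 2 ^ d := one_le_pow₀ (by norm_num)
  have h2 : (0 : ℝ) ≤ 2 ^ k * ‖y‖ := by positivity
  nlinarith

lemma V_ne_zero {n : ℕ} (k d : ℕ) (y : Rn n) : V k d y ≠ 0 :=
  ENNReal.inv_ne_zero.2 ENNReal.ofReal_ne_top

lemma V_le_one {n : ℕ} (k d : ℕ) (y : Rn n) : V k d y ≤ 1 := by
  rw [V, ENNReal.inv_le_one]
  simpa using ENNReal.ofReal_le_ofReal (V_pos_real k d y)

lemma V_ne_top {n : ℕ} (k d : ℕ) (y : Rn n) : V k d y ≠ ∞ :=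
  ((V_le_one k d y).trans_lt ENNReal.one_lt_top).ne

lemma V_mul_le {n : ℕ} (k d e : ℕ) (x y z : Rn n) :
    V k d (x - y) * V (k + d) e (y - z) ≤ V k (d + e) (x - z) := by
  unfold V
  rw [← ENNReal.mul_inv (Or.inr ENNReal.ofReal_ne_top) (Or.inl ENNReal.ofReal_ne_top), ← ENNReal.ofReal_mul (by positivity)]
  apply ENNReal.inv_le_inv.2
  apply ENNReal.ofReal_le_ofReal
  have h : ‖x - z‖ ≤ ‖x - y‖ + ‖y - z‖ := norm_sub_le_norm_sub_add_norm_sub _ _ _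
  have h1 : (1 : ℝ) ≤ 2 ^ d := one_le_pow₀ (by norm_num)
  have h3 : (0 : ℝ) < 2 ^ k := by positivity
  have e1 : (2 : ℝ) ^ (d + e) = 2 ^ d * 2 ^ e := pow_add _ _ _
  have e2 : (2 : ℝ) ^ (k + d) = 2 ^ k * 2 ^ d := pow_add _ _ _
  rw [e1, e2]
  have : 1 + 2 ^ k * ‖x - z‖ ≤ (1 + 2 ^ k * ‖x - y‖) * (1 + 2 ^ k * 2 ^ d * ‖y - z‖) := by
    have a1 : 2 ^ k * ‖x - z‖ ≤ 2 ^ k * ‖x - y‖ + 2 ^ k * ‖y - z‖ := by nlinarith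
    have a2 : 2 ^ k * ‖y - z‖ * 1 ≤ 2 ^ k * ‖y - z‖ * 2 ^ d := by gcongr
    have a3 : (0 : ℝ) ≤ (2 ^ k * ‖x - y‖) * (2 ^ k * 2 ^ d * ‖y - z‖) := by positivity
    nlinarith
  calc (2 : ℝ) ^ d * 2 ^ e * (1 + 2 ^ k * ‖x - z‖)
      ≤ 2 ^ d * 2 ^ e * ((1 + 2 ^ k * ‖x - y‖) * (1 + 2 ^ k * 2 ^ d * ‖y - z‖)) := by gcongr
    _ = _ := by ring

lemma V_le_V {n : ℕ} (k d : ℕ) (y : Rn n) : V k d y ≤ V (k + d) 0 y := by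
  unfold V
  apply ENNReal.inv_le_inv.2
  apply ENNReal.ofReal_le_ofReal
  have h1 : (1 : ℝ) ≤ 2 ^ d := one_le_pow₀ (by norm_num)
  rw [pow_add]
  nlinarith

lemma V_measurable {n : ℕ} (k d : ℕ) : Measurable (V (n := n) k d) := by
  unfold V; fun_prop

lemma V_eq {n : ℕ} (k d : ℕ) (y : Rn n) : V k d y = e2 (-d) * V k 0 y := by
  unfold V
  rw [ENNReal.ofReal_mul (by positivity), ENNReal.mul_inv (by simp) (by simp)]
  congr 1
  · rw [e2, ENNReal.rpow_neg, ENNReal.rpow_natCast, ENNReal.ofReal_pow (by norm_num)]; simp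
  · simp

/-- integral constant -/
def kap (n : ℕ) (ρ : ℝ) : ℝ≥0∞ := ∫⁻ y : Rn n, V 0 0 y ^ ρ

lemma kap_lt_top {n : ℕ} {ρ : ℝ} (h : (n : ℝ) < ρ) : kap n ρ < ∞ := by
  have h0 : 0 < ρ := lt_of_le_of_lt (by positivity) h
  have := finite_integral_one_add_norm (μ := (volume : Measure (Rn n))) (r := ρ) (by simpa using h)
  refine lt_of_le_of_lt (le_of_eq ?_) this
  unfold kap V
  congr 1
  ext y
  have hp : 0 < 1 + ‖y‖ := by positivity
  simp only [pow_zero, one_mul]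
  rw [ENNReal.inv_rpow, ENNReal.ofReal_rpow_of_pos hp, Real.rpow_neg hp.le, ENNReal.ofReal_inv_of_pos (by positivity)]

lemma lintegral_V {n : ℕ} (k d : ℕ) {ρ : ℝ} (hρ : 0 ≤ ρ) :
    ∫⁻ y : Rn n, e2 (k * n) * V k d y ^ ρ = e2 (-(d * ρ)) * kap n ρ := by
  have h1 : ∀ y : Rn n, V k d y ^ ρ = e2 (-(d * ρ)) * V 0 0 ((2 : ℝ) ^ k • y) ^ ρ := by
    intro y
    rw [V_eq, ENNReal.mul_rpow_of_nonneg _ _ hρ, e2_rpow]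
    congr 2
    · ring
    · unfold V; simp [norm_smul]
  simp_rw [h1]
  rw [lintegral_const_mul _ (by have := V_measurable (n := n) 0 0; fun_prop),
    lintegral_const_mul _ (by have := V_measurable (n := n) 0 0; fun_prop)]
  have h2 : ∫⁻ y : Rn n, V 0 0 ((2 : ℝ) ^ k • y) ^ ρ =
      ENNReal.ofReal |(((2 : ℝ) ^ k) ^ Module.finrank ℝ (Rn n))⁻¹| • ∫⁻ y : Rn n, V 0 0 y ^ ρ := by
    have hm : Measurable fun y : Rn n => V 0 0 y ^ ρ := (V_measurable 0 0).pow_const _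
    have h0 : ((2 : ℝ) ^ k) ≠ 0 := by positivity
    rw [← lintegral_smul_measure, ← Measure.map_addHaar_smul (volume : Measure (Rn n)) h0,
      lintegral_map hm (by fun_prop)]
  rw [h2]
  unfold kap
  have h3 : e2 (k * n) * ENNReal.ofReal |(((2 : ℝ) ^ k) ^ Module.finrank ℝ (Rn n))⁻¹| = 1 := by
    rw [e2_ofReal, ← ENNReal.ofReal_mul (by positivity)]
    rw [abs_of_nonneg (by positivity), finrank_euclideanSpace_fin, ← pow_mul]
    have : (2 : ℝ) ^ ((k : ℝ) * n) = 2 ^ (k * n) := by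
      rw [← Real.rpow_natCast]; push_cast; rfl
    rw [this, mul_inv_cancel₀ (by positivity)]; simp
  rw [smul_eq_mul]
  calc _ = e2 (-(d * ρ)) * ((e2 (k * n) * ENNReal.ofReal |(((2 : ℝ) ^ k) ^ Module.finrank ℝ (Rn n))⁻¹|) * ∫⁻ (x : Rn n), V 0 0 x ^ ρ) := by ring
    _ = _ := by rw [h3, one_mul]

end Aux

namespace Aux

/-- high frequency averages -/
def RR {n : ℕ} (ρ : ℝ) (H : ℕ → Rn n → ℝ≥0∞) (k : ℕ) (x : Rn n) : ℝ≥0∞ :=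
  ∑' d : ℕ, ∫⁻ z, e2 ((k + d : ℕ) * n) * V k d (x - z) ^ ρ * H (k + d) z

/-- Peetre type maximal function -/
def MM {n : ℕ} (N : ℝ) (F : ℕ → Rn n → ℝ≥0∞) (k : ℕ) (x : Rn n) : ℝ≥0∞ :=
  ⨆ (d : ℕ) (y : Rn n), V k d (x - y) ^ N * F (k + d) y

lemma le_MM {n : ℕ} (N : ℝ) (F : ℕ → Rn n → ℝ≥0∞) (k d : ℕ) (x y : Rn n) :
    V k d (x - y) ^ N * F (k + d) y ≤ MM N F k x :=
  le_iSup₂ (f := fun (d : ℕ) (y : Rn n) => V k d (x - y) ^ N * F (k + d) y) d y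

lemma V_zero {n : ℕ} (k : ℕ) : V k 0 (0 : Rn n) = 1 := by simp [V]

lemma shift_RR {n : ℕ} {ρ : ℝ} (hρ : 0 ≤ ρ) (H : ℕ → Rn n → ℝ≥0∞) (k d : ℕ) (x y : Rn n) :
    V k d (x - y) ^ ρ * RR ρ H (k + d) y ≤ RR ρ H k x := by
  unfold RR
  rw [← ENNReal.tsum_mul_left]
  calc _ ≤ ∑' e : ℕ, ∫⁻ z, e2 ((k + (d + e) : ℕ) * n) * V k (d + e) (x - z) ^ ρ * H (k + (d + e)) z := by
        refine ENNReal.tsum_le_tsum fun e => ?_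
        rw [← lintegral_const_mul' _ _ (ENNReal.rpow_ne_top_of_nonneg hρ (V_ne_top _ _ _))]
        refine lintegral_mono fun z => ?_
        have h := ENNReal.rpow_le_rpow (V_mul_le k d e x y z) hρ
        rw [ENNReal.mul_rpow_of_nonneg _ _ hρ] at h
        rw [← add_assoc]
        calc _ = e2 ((k + d + e : ℕ) * n) * (V k d (x - y) ^ ρ * V (k + d) e (y - z) ^ ρ) * H (k + d + e) z := by ring
          _ ≤ _ := by gcongr
    _ ≤ _ := ENNReal.tsum_comp_le_tsum_of_injective (f := fun e => d + e) (add_right_injective d) (fun e => ∫⁻ z, e2 ((k + e : ℕ) * n) * V k e (x - z) ^ ρ * H (k + e) z)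

lemma RR_anti {n : ℕ} {ρ ρ' : ℝ} (h : ρ ≤ ρ') (H : ℕ → Rn n → ℝ≥0∞) (k : ℕ) (x : Rn n) :
    RR ρ' H k x ≤ RR ρ H k x := by
  unfold RR
  refine ENNReal.tsum_le_tsum fun e => lintegral_mono fun z => ?_
  have := ENNReal.rpow_le_rpow_of_exponent_ge (V_le_one k e (x - z)) h
  gcongr

/-- The self-improving estimate. -/
def K1 {n : ℕ} (N : ℝ) (C : ℝ≥0∞) (F : ℕ → Rn n → ℝ≥0∞) : Prop :=
  ∀ l y, F l y ≤ C * RR N F l y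

lemma MM_le {n : ℕ} {N r : ℝ} (hN : 0 ≤ N) (hr : 0 < r) (hr1 : r ≤ 1) {C : ℝ≥0∞}
    {F : ℕ → Rn n → ℝ≥0∞} (h : K1 N C F) (k : ℕ) (x : Rn n) (hfin : MM N F k x ≠ ∞) :
    MM N F k x ^ r ≤ C * RR (N * r) (fun j z => F j z ^ r) k x := by
  set M := MM N F k x with hM
  have hM0 : M ^ (1 - r) ≠ ∞ := ENNReal.rpow_ne_top_of_nonneg (by linarith) hfin
  have key : RR N F k x ≤ M ^ (1 - r) * RR (N * r) (fun j z => F j z ^ r) k x := by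
    unfold RR
    rw [← ENNReal.tsum_mul_left]
    refine ENNReal.tsum_le_tsum fun d => ?_
    rw [← lintegral_const_mul' _ _ hM0]
    refine lintegral_mono fun z => ?_
    have h1 := le_MM N F k d x z
    have e : V k d (x - z) ^ N * F (k + d) z =
        (V k d (x - z) ^ N * F (k + d) z) ^ (1 - r) * (V k d (x - z) ^ N * F (k + d) z) ^ r := by
      rw [← ENNReal.rpow_add_of_nonneg _ _ (by linarith) hr.le]; simp
    rw [mul_assoc, e, ENNReal.mul_rpow_of_nonneg _ _ hr.le, ← ENNReal.rpow_mul]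
    calc _ ≤ e2 ((k + d : ℕ) * n) * (M ^ (1 - r) * (V k d (x - z) ^ (N * r) * F (k + d) z ^ r)) := by
          gcongr
      _ = _ := by ring
  have h2 : M ≤ C * (M ^ (1 - r) * RR (N * r) (fun j z => F j z ^ r) k x) := by
    refine le_trans ?_ (mul_le_mul_right key C)
    refine iSup₂_le fun d y => ?_
    calc _ ≤ V k d (x - y) ^ N * (C * RR N F (k + d) y) := by gcongr; exact h _ _
      _ = C * (V k d (x - y) ^ N * RR N F (k + d) y) := by ring
      _ ≤ _ := by gcongr; exact shift_RR hN F k d x y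
  by_cases hz : M = 0
  · rw [hz, ENNReal.zero_rpow_of_pos hr]; exact zero_le
  have e : M = M ^ (1 - r) * M ^ r := by
    rw [← ENNReal.rpow_add_of_nonneg _ _ (by linarith) hr.le]; simp
  have hM00 : M ^ (1 - r) ≠ 0 := (ENNReal.rpow_pos (pos_iff_ne_zero.2 hz) hfin).ne'
  rw [← ENNReal.mul_le_mul_iff_right hM00 hM0, ← e]
  calc M ≤ _ := h2
    _ = _ := by ring

/-- temperedness -/
def Temp {n : ℕ} (F : ℕ → Rn n → ℝ≥0∞) : Prop :=
  ∃ (A : ℝ≥0∞) (N : ℕ), A ≠ ∞ ∧ ∀ l y, F l y ≤ A * (2 ^ l * ENNReal.ofReal (1 + ‖y‖)) ^ N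

lemma V_temp {n : ℕ} (k d : ℕ) (x y : Rn n) :
    V k d (x - y) * (2 ^ (k + d) * ENNReal.ofReal (1 + ‖y‖)) ≤
      ENNReal.ofReal (2 ^ k * (1 + ‖x‖)) := by
  unfold V
  rw [mul_comm, ← div_eq_mul_inv]
  refine ENNReal.div_le_of_le_mul ?_
  have e : (2 : ℝ≥0∞) ^ (k + d) = ENNReal.ofReal (2 ^ (k + d)) := by
    rw [ENNReal.ofReal_pow (by norm_num)]; simp
  rw [e, ← ENNReal.ofReal_mul (by positivity), ← ENNReal.ofReal_mul (by positivity)]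
  apply ENNReal.ofReal_le_ofReal
  have h : ‖y‖ ≤ ‖x‖ + ‖x - y‖ := by
    have := norm_sub_norm_le y x
    rw [norm_sub_rev] at this; linarith
  have h1 : (1 : ℝ) ≤ 2 ^ k := one_le_pow₀ (by norm_num)
  have h2 : 1 + ‖y‖ ≤ (1 + ‖x‖) * (1 + 2 ^ k * ‖x - y‖) := by
    nlinarith [norm_nonneg x, norm_nonneg (x - y), mul_nonneg (norm_nonneg x) (norm_nonneg (x-y)),
      mul_nonneg (norm_nonneg x) (mul_nonneg (by positivity : (0:ℝ) ≤ 2 ^ k) (norm_nonneg (x-y))),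
      mul_le_mul_of_nonneg_right h1 (norm_nonneg (x - y))]
  calc (2 : ℝ) ^ (k + d) * (1 + ‖y‖) ≤ 2 ^ (k + d) * ((1 + ‖x‖) * (1 + 2 ^ k * ‖x - y‖)) := by gcongr
    _ = _ := by rw [pow_add]; ring

lemma MM_temp {n : ℕ} {F : ℕ → Rn n → ℝ≥0∞} (h : Temp F) :
    ∃ N0 : ℕ, ∀ N : ℕ, N0 ≤ N → ∀ k x, MM N F k x ≠ ∞ := by
  obtain ⟨A, N0, hA, h⟩ := h
  refine ⟨N0, fun N hN k x => ?_⟩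
  have hb : MM N F k x ≤ A * ENNReal.ofReal (2 ^ k * (1 + ‖x‖)) ^ N0 := by
    refine iSup₂_le fun d y => ?_
    have h1 : V k d (x - y) ^ (N : ℝ) ≤ V k d (x - y) ^ N0 := by
      rw [ENNReal.rpow_natCast]
      exact pow_le_pow_right_of_le_one' (V_le_one _ _ _) hN
    calc _ ≤ V k d (x - y) ^ N0 * (A * (2 ^ (k + d) * ENNReal.ofReal (1 + ‖y‖)) ^ N0) := by
          gcongr; exact h _ _
      _ = A * (V k d (x - y) * (2 ^ (k + d) * ENNReal.ofReal (1 + ‖y‖))) ^ N0 := by ring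
      _ ≤ _ := by gcongr; exact V_temp k d x y
  exact (hb.trans_lt (ENNReal.mul_lt_top hA.lt_top (ENNReal.pow_lt_top ENNReal.ofReal_lt_top))).ne

lemma MM_le' {n : ℕ} {r : ℝ} (hr : 0 < r) (hr1 : r ≤ 1) {CC : ℕ → ℝ≥0∞} (hCC : ∀ N, CC N ≠ ∞)
    {F : ℕ → Rn n → ℝ≥0∞} (hT : Temp F) (h : ∀ N : ℕ, K1 N (CC N) F) (N k : ℕ) (x : Rn n) :
    MM N F k x ^ r ≤ (CC N + 1) * RR (N * r) (fun j z => F j z ^ r) k x := by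
  obtain ⟨N0, hN0⟩ := MM_temp hT
  set W := RR (N * r) (fun j z => F j z ^ r) k x with hW
  by_cases hWt : W = ∞
  · rw [hWt, ENNReal.mul_top (by simp)]; exact le_top
  suffices hs : MM N F k x ≠ ∞ by
    refine (MM_le (Nat.cast_nonneg N) hr hr1 (h N) k x hs).trans ?_
    gcongr
    exact le_self_add
  set N1 := max N N0
  have hb : MM N F k x ^ r ≤ CC N1 * W := by
    have : MM N F k x ≤ (CC N1 * W) ^ r⁻¹ := by
      refine iSup₂_le fun d y => ?_
      rw [ENNReal.le_rpow_inv_iff hr, ENNReal.mul_rpow_of_nonneg _ _ hr.le, ← ENNReal.rpow_mul]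
      have h1 : F (k + d) y ^ r ≤ CC N1 * RR (N * r) (fun j z => F j z ^ r) (k + d) y := by
        have h2 := le_MM N1 F (k + d) 0 y y
        simp only [sub_self, V_zero, ENNReal.one_rpow, one_mul, add_zero] at h2
        refine (ENNReal.rpow_le_rpow h2 hr.le).trans
          ((MM_le (Nat.cast_nonneg N1) hr hr1 (h N1) _ y (hN0 N1 (le_max_right _ _) _ _)).trans ?_)
        gcongr
        apply RR_anti
        have : (N : ℝ) ≤ N1 := by exact_mod_cast le_max_left _ _
        gcongr
      calc _ ≤ V k d (x - y) ^ (N * r) * (CC N1 * RR (N * r) (fun j z => F j z ^ r) (k + d) y) := by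
            gcongr
        _ = CC N1 * (V k d (x - y) ^ (N * r) * RR (N * r) (fun j z => F j z ^ r) (k + d) y) := by ring
        _ ≤ _ := by gcongr; exact shift_RR (by positivity) _ k d x y
    rwa [ENNReal.le_rpow_inv_iff hr] at this
  intro htop
  rw [htop, ENNReal.top_rpow_of_pos hr] at hb
  exact (ENNReal.mul_ne_top (hCC N1) hWt) (top_le_iff.1 hb)

end Aux

namespace Aux

lemma eLpNorm_cmul {α : Type*} [MeasurableSpace α] {μ : Measure α} {u c : ℝ≥0∞} (hc : c ≠ ∞)
    (h : α → ℝ≥0∞) : eLpNorm (fun x => c * h x) u μ ≤ c * eLpNorm h u μ := by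
  lift c to ℝ≥0 using hc
  exact eLpNorm_le_nnreal_smul_eLpNorm_of_ae_le_mul' (c := c) (ae_of_all _ fun x => by simp) u

lemma eLpNorm_mono_e {α : Type*} [MeasurableSpace α] {μ : Measure α} {u : ℝ≥0∞}
    {f g : α → ℝ≥0∞} (h : ∀ x, f x ≤ g x) : eLpNorm f u μ ≤ eLpNorm g u μ :=
  eLpNorm_mono_enorm fun x => by simpa using h x

lemma eLpNorm_rp {α : Type*} [MeasurableSpace α] {μ : Measure α} {p : ℝ≥0∞} {r : ℝ} (hr : 0 < r)
    (f : α → ℝ≥0∞) : eLpNorm (fun x => f x ^ r) (p / ENNReal.ofReal r) μ = eLpNorm f p μ ^ r := by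
  have := eLpNorm_enorm_rpow (p := p / ENNReal.ofReal r) (μ := μ) f hr
  simp only [enorm_eq_self] at this
  rw [this, ENNReal.div_mul_cancel (by simpa using hr) ENNReal.ofReal_ne_top]

/-- geometric constant -/
def gc (η : ℝ) : ℝ≥0∞ := ∑' d : ℕ, e2 (-(d * η))

lemma gc_ne_top {η : ℝ} (h : 0 < η) : gc η ≠ ∞ := by
  have : gc η = ∑' d : ℕ, (e2 (-η)) ^ d := by
    unfold gc
    congr 1; ext d
    rw [← ENNReal.rpow_natCast, e2_rpow]; congr 1; ring
  rw [this, ENNReal.tsum_geometric]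
  rw [ENNReal.inv_ne_top]
  have h1 : e2 (-η) < 1 := by
    rw [e2_ofReal]
    have : (2 : ℝ) ^ (-η) < 1 := Real.rpow_lt_one_of_one_lt_of_neg (by norm_num) (by linarith)
    rw [← ENNReal.ofReal_one]
    exact (ENNReal.ofReal_lt_ofReal_iff (by norm_num)).2 this
  exact (tsub_pos_of_lt h1).ne'

lemma one_le_gc (η : ℝ) : 1 ≤ gc η := by
  have := ENNReal.le_tsum (f := fun d : ℕ => e2 (-(d * η))) 0
  simpa [e2_zero, gc] using this

lemma rpow_sum_le {r : ℝ} (hr : 0 < r) (hr1 : r ≤ 1) (s : Finset ℕ) (a : ℕ → ℝ≥0∞) :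
    (∑ i ∈ s, a i) ^ r ≤ ∑ i ∈ s, a i ^ r := by
  classical
  induction s using Finset.induction_on with
  | empty => simp [hr]
  | insert i s hi ih =>
    rw [Finset.sum_insert hi, Finset.sum_insert hi]
    exact (ENNReal.rpow_add_le_add_rpow _ _ hr.le hr1).trans (by gcongr)

lemma eLpNorm_shift {v : ℝ≥0∞} (hv : 0 < v) (A : ℕ → ℝ≥0∞) (d : ℕ) :
    eLpNorm (fun k => A (k + d)) v Measure.count ≤ eLpNorm A v Measure.count := by
  rw [← lqSum_eq v hv, ← lqSum_eq v hv]
  unfold lqSum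
  split_ifs
  · exact iSup_le fun j => le_iSup A (j + d)
  · refine ENNReal.rpow_le_rpow ?_ (by positivity)
    exact ENNReal.tsum_comp_le_tsum_of_injective (f := fun e => e + d) (add_left_injective d) (fun e => A e ^ v.toReal)

lemma disc_up {v : ℝ≥0∞} (hv : 1 ≤ v) (A : ℕ → ℝ≥0∞) (η : ℝ) :
    eLpNorm (fun k => ∑' d : ℕ, e2 (-(d * η)) * A (k + d)) v Measure.count ≤
      gc η * eLpNorm A v Measure.count := by
  refine (eLpNorm_tsum_le' hv (fun i => measurable_of_countable _)).trans ?_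
  unfold gc
  rw [← ENNReal.tsum_mul_right]
  refine ENNReal.tsum_le_tsum fun d => ?_
  refine (eLpNorm_cmul (e2_ne_top _) _).trans ?_
  gcongr
  exact eLpNorm_shift (lt_of_lt_of_le one_pos hv) A d

lemma disc_low {v : ℝ≥0∞} (hv : 1 ≤ v) (A : ℕ → ℝ≥0∞) (η : ℝ) :
    eLpNorm (fun k => ∑ i ∈ Finset.range (k + 1), e2 (-((k - i : ℕ) * η)) * A i) v Measure.count ≤
      gc η * eLpNorm A v Measure.count := by
  set K : ℕ → ℕ → ℝ≥0∞ := fun k i => if i ∈ Finset.range (k + 1) then e2 (-((k - i : ℕ) * η)) else 0 with hK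
  have h := schur (μ := Measure.count) (ν := Measure.count) (K := K) (A := gc η) hv
    (measurable_of_countable _) ?_ ?_ (measurable_of_countable A)
  · convert h using 2
    ext k
    rw [lintegral_count, tsum_eq_sum (s := Finset.range (k + 1))]
    · exact Finset.sum_congr rfl fun i hi => by simp only [hK]; rw [if_pos hi]
    · intro i hi; simp only [hK]; rw [if_neg hi, zero_mul]
  · intro k
    rw [lintegral_count, tsum_eq_sum (s := Finset.range (k + 1))]
    · calc _ = ∑ i ∈ Finset.range (k + 1), e2 (-((k - i : ℕ) * η)) :=
            Finset.sum_congr rfl fun i hi => by simp only [hK]; rw [if_pos hi]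
        _ = ∑ i ∈ Finset.range (k + 1), e2 (-(i * η)) := by
            rw [← Finset.sum_range_reflect]
            refine Finset.sum_congr rfl fun i hi => ?_
            have : i < k + 1 := Finset.mem_range.1 hi
            congr 4; omega
        _ ≤ _ := ENNReal.sum_le_tsum _
    · intro i hi; simp only [hK]; rw [if_neg hi]
  · intro i
    rw [lintegral_count, ← Summable.sum_add_tsum_nat_add' (k := i) ENNReal.summable]
    have h0 : ∑ k ∈ Finset.range i, K k i = 0 := by
      refine Finset.sum_eq_zero fun k hk => ?_
      simp only [hK]; rw [if_neg]
      simp at hk ⊢; omega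
    rw [h0, zero_add]
    refine le_of_eq (tsum_congr fun d => ?_)
    simp only [hK]; rw [if_pos (by simp), Nat.add_sub_cancel]

lemma meas_kern {n : ℕ} (c : ℝ≥0∞) (k d : ℕ) (ρ : ℝ) :
    Measurable (Function.uncurry fun x z : Rn n => c * V k d (x - z) ^ ρ) := by
  have := V_measurable (n := n) k d
  unfold Function.uncurry
  fun_prop

lemma lint_kern {n : ℕ} (k d : ℕ) {ρ : ℝ} (hρ : 0 ≤ ρ) :
    ∫⁻ y : Rn n, e2 ((k + d : ℕ) * n) * V k d y ^ ρ = e2 (-(d * (ρ - n))) * kap n ρ := by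
  have e : ∀ y : Rn n, e2 ((k + d : ℕ) * n) * V k d y ^ ρ = e2 (d * n) * (e2 (k * n) * V k d y ^ ρ) := by
    intro y
    rw [← mul_assoc, ← e2_add]; congr 2; push_cast; ring
  simp_rw [e]
  rw [lintegral_const_mul' _ _ (e2_ne_top _), lintegral_V k d hρ, ← mul_assoc, ← e2_add]
  congr 2; ring

lemma norm_RR {n : ℕ} {u : ℝ≥0∞} (hu : 1 ≤ u) {ρ : ℝ} (hρ : 0 ≤ ρ) {H : ℕ → Rn n → ℝ≥0∞}
    (hH : ∀ j, Measurable (H j)) (k : ℕ) :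
    eLpNorm (RR ρ H k) u volume ≤
      kap n ρ * ∑' d : ℕ, e2 (-(d * (ρ - n))) * eLpNorm (H (k + d)) u volume := by
  unfold RR
  refine (eLpNorm_tsum_le' hu ?_).trans ?_
  · intro d
    have h1 := (meas_kern (n := n) (e2 ((k + d : ℕ) * n)) k d ρ).mul ((hH (k + d)).comp measurable_snd)
    exact h1.lintegral_prod_right'
  · rw [← ENNReal.tsum_mul_left]
    refine ENNReal.tsum_le_tsum fun d => ?_
    rw [← mul_assoc, mul_comm (kap n ρ)]
    refine schur hu (meas_kern _ k d ρ) ?_ ?_ (hH _)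
    · intro x
      rw [lintegral_sub_left_eq_self (fun y => e2 ((k + d : ℕ) * n) * V k d y ^ ρ) x,
        lint_kern k d hρ]
    · intro x
      rw [lintegral_sub_right_eq_self (fun y => e2 ((k + d : ℕ) * n) * V k d y ^ ρ) x,
        lint_kern k d hρ]

/-- The pointwise bound for the target sequence. -/
def Gb {n : ℕ} (N T : ℝ) (C : ℝ≥0∞) (F G : ℕ → Rn n → ℝ≥0∞) : Prop :=
  ∀ k x, G k x ≤ C * (RR N F k x + ∑ i ∈ Finset.range k,
    e2 (-((k - i : ℕ) * T)) * ∫⁻ z, e2 (i * n) * V i 0 (x - z) ^ N * F i z)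

lemma V_split {n : ℕ} {N' N : ℝ} (hN : 0 ≤ N) (hNN : N ≤ N') (F : ℕ → Rn n → ℝ≥0∞) (c : ℝ≥0∞) (k d : ℕ) (x : Rn n) :
    ∫⁻ z, c * V k d (x - z) ^ N' * F (k + d) z ≤
      MM N F k x * ∫⁻ z : Rn n, c * V k d z ^ (N' - N) := by
  rw [← lintegral_sub_left_eq_self (fun y => c * V k d y ^ (N' - N)) x,
    ← lintegral_const_mul]
  · refine lintegral_mono fun z => ?_
    have e : V k d (x - z) ^ N' = V k d (x - z) ^ (N' - N) * V k d (x - z) ^ N := by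
      rw [← ENNReal.rpow_add_of_nonneg _ _ (by linarith) hN]; congr 1; ring
    rw [e]
    calc _ = c * V k d (x - z) ^ (N' - N) * (V k d (x - z) ^ N * F (k + d) z) := by ring
      _ ≤ c * V k d (x - z) ^ (N' - N) * MM N F k x := by gcongr; exact le_MM N F k d x z
      _ = _ := by ring
  · have := V_measurable (n := n) k d
    fun_prop

lemma G_le_MM {n : ℕ} {N' N T : ℝ} (hN : 0 ≤ N) (hNN : N + n ≤ N') {C : ℝ≥0∞}
    {F G : ℕ → Rn n → ℝ≥0∞} (h : Gb N' T C F G) (k : ℕ) (x : Rn n) :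
    G k x ≤ (C * (gc (N' - N - n) * kap n (N' - N))) *
      ∑ i ∈ Finset.range (k + 1), e2 (-((k - i : ℕ) * T)) * MM N F i x := by
  have hn : (0 : ℝ) ≤ n := Nat.cast_nonneg n
  refine (h k x).trans ?_
  rw [mul_assoc]
  gcongr
  rw [Finset.sum_range_succ, mul_add, add_comm]
  gcongr ?_ + ?_
  · rw [Finset.mul_sum]
    refine Finset.sum_le_sum fun i _ => ?_
    have h1 := V_split hN (by linarith : N ≤ N') F (e2 (i * n)) i 0 x
    rw [lintegral_V i 0 (by linarith : 0 ≤ N' - N)] at h1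
    simp only [Nat.cast_zero, zero_mul, neg_zero, e2_zero, one_mul, add_zero] at h1
    calc _ ≤ e2 (-((k - i : ℕ) * T)) * (MM N F i x * kap n (N' - N)) := by gcongr
      _ = 1 * (kap n (N' - N) * (e2 (-((k - i : ℕ) * T)) * MM N F i x)) := by ring
      _ ≤ gc (N' - N - n) * (kap n (N' - N) * (e2 (-((k - i : ℕ) * T)) * MM N F i x)) := by
          gcongr; exact one_le_gc _
      _ = _ := by ring
  · simp only [tsub_self, Nat.cast_zero, zero_mul, neg_zero, e2_zero, one_mul]
    unfold RR gc
    rw [← ENNReal.tsum_mul_right, ← ENNReal.tsum_mul_right]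
    refine ENNReal.tsum_le_tsum fun d => ?_
    refine (V_split hN (by linarith : N ≤ N') F _ k d x).trans ?_
    rw [lint_kern k d (by linarith : 0 ≤ N' - N)]
    rw [mul_comm]

lemma abstract_main (n : ℕ) (s T : ℝ) (hT : s < T) (p q : ℝ≥0∞) (hp : 0 < p) (hq : 0 < q) :
    ∃ N' : ℕ, ∀ (CC : ℕ → ℝ≥0∞), (∀ N, CC N ≠ ∞) → ∀ C2 : ℝ≥0∞, C2 ≠ ∞ → ∃ C' : ℝ≥0∞, C' ≠ ∞ ∧
      ∀ F G : ℕ → Rn n → ℝ≥0∞, (∀ j, Measurable (F j)) → Temp F →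
        (∀ N : ℕ, K1 N (CC N) F) → Gb N' T C2 F G →
        lqSum q (fun k => e2 (k * s) * eLpNorm (G k) p volume) ≤
          C' * lqSum q (fun k => e2 (k * s) * eLpNorm (F k) p volume) := by
  obtain ⟨r, hr, hr1, hrp, hrq⟩ : ∃ r : ℝ, 0 < r ∧ r ≤ 1 ∧ ENNReal.ofReal r ≤ p ∧
      ENNReal.ofReal r ≤ q := by
    have hm : min 1 (min p q) ≠ ∞ := ((min_le_left _ _).trans_lt ENNReal.one_lt_top).ne
    refine ⟨(min 1 (min p q)).toReal, ENNReal.toReal_pos ?_ hm, ?_, ?_, ?_⟩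
    · exact (lt_min one_pos (lt_min hp hq)).ne'
    · exact ENNReal.toReal_le_of_le_ofReal (by norm_num) (by simp)
    · rw [ENNReal.ofReal_toReal hm]; exact (min_le_right _ _).trans (min_le_left _ _)
    · rw [ENNReal.ofReal_toReal hm]; exact (min_le_right _ _).trans (min_le_right _ _)
  have hr0 : ENNReal.ofReal r ≠ 0 := by simpa using hr
  have hu : 1 ≤ p / ENNReal.ofReal r := by
    rw [ENNReal.le_div_iff_mul_le (Or.inl hr0) (Or.inl ENNReal.ofReal_ne_top)]; simpa using hrp
  have hv : 1 ≤ q / ENNReal.ofReal r := by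
    rw [ENNReal.le_div_iff_mul_le (Or.inl hr0) (Or.inl ENNReal.ofReal_ne_top)]; simpa using hrq
  set u := p / ENNReal.ofReal r with hudef
  set v := q / ENNReal.ofReal r with hvdef
  obtain ⟨N, hN⟩ := exists_nat_gt ((n + |s| * r) / r)
  rw [div_lt_iff₀ hr] at hN
  have hn0 : (0 : ℝ) ≤ n := Nat.cast_nonneg n
  have habs : 0 ≤ |s| * r := by positivity
  have hsr : -(s * r) ≤ |s| * r := by nlinarith [neg_abs_le s]
  have hN0 : (0 : ℝ) ≤ N := Nat.cast_nonneg N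
  refine ⟨N + n + 1, fun CC hCC C2 hC2 => ?_⟩
  set N' : ℝ := ((N + n + 1 : ℕ) : ℝ) with hN'
  have hN'e : N' = N + n + 1 := by rw [hN']; push_cast; ring
  set c1 := C2 * (gc (N' - N - n) * kap n (N' - N)) with hc1
  have hc1t : c1 ≠ ∞ := ENNReal.mul_ne_top hC2 (ENNReal.mul_ne_top (gc_ne_top (by linarith))
    (kap_lt_top (by linarith)).ne)
  set c2 := c1 ^ r * ((CC N + 1) * kap n (N * r)) with hc2
  have hc2t : c2 ≠ ∞ := ENNReal.mul_ne_top (ENNReal.rpow_ne_top_of_nonneg hr.le hc1t)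
    (ENNReal.mul_ne_top (by simpa using hCC N) (kap_lt_top (by linarith)).ne)
  set c3 := c2 * (gc ((T - s) * r) * gc (N * r - n + s * r)) with hc3
  have hc3t : c3 ≠ ∞ := ENNReal.mul_ne_top hc2t (ENNReal.mul_ne_top (gc_ne_top (mul_pos (by linarith) hr))
    (gc_ne_top (by linarith)))
  refine ⟨c3 ^ r⁻¹, ENNReal.rpow_ne_top_of_nonneg (by positivity) hc3t, fun F G hF hTe hK hG => ?_⟩
  -- pointwise
  set H : ℕ → Rn n → ℝ≥0∞ := fun j z => F j z ^ r with hH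
  have hHm : ∀ j, Measurable (H j) := fun j => (hF j).pow_const _
  have hpt : ∀ k x, G k x ^ r ≤ c1 ^ r * ((CC N + 1) *
      ∑ i ∈ Finset.range (k + 1), e2 (-((k - i : ℕ) * (T * r))) * RR (N * r) H i x) := by
    intro k x
    have h1 := G_le_MM (N := N) (Nat.cast_nonneg N) (by linarith) hG k x
    refine (ENNReal.rpow_le_rpow h1 hr.le).trans ?_
    rw [ENNReal.mul_rpow_of_nonneg _ _ hr.le]
    gcongr
    refine (rpow_sum_le hr hr1 _ _).trans ?_
    rw [Finset.mul_sum]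
    refine Finset.sum_le_sum fun i _ => ?_
    rw [ENNReal.mul_rpow_of_nonneg _ _ hr.le, e2_rpow]
    have h2 := MM_le' hr hr1 hCC hTe hK N i x
    calc _ ≤ e2 (-((k - i : ℕ) * T) * r) * ((CC N + 1) * RR (N * r) H i x) := by gcongr
      _ = _ := by
        have : -((k - i : ℕ) * T) * r = -((k - i : ℕ) * (T * r)) := by ring
        rw [this]; ring
  -- Lp norms
  set h : ℕ → ℝ≥0∞ := fun j => eLpNorm (H j) u volume with hh
  have hRm : ∀ i, Measurable (RR (N * r) H i) := by
    intro i
    unfold RR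
    refine Measurable.tsum fun d => ?_
    have h1 := (meas_kern (n := n) (e2 ((i + d : ℕ) * n)) i d (N * r)).mul ((hHm (i + d)).comp measurable_snd)
    exact h1.lintegral_prod_right'
  have hLp : ∀ k, eLpNorm (fun x => G k x ^ r) u volume ≤ c2 *
      ∑ i ∈ Finset.range (k + 1), e2 (-((k - i : ℕ) * (T * r))) *
        ∑' d : ℕ, e2 (-(d * (N * r - n))) * h (i + d) := by
    intro k
    refine (eLpNorm_mono_e (hpt k)).trans ?_
    refine (eLpNorm_cmul (ENNReal.rpow_ne_top_of_nonneg hr.le hc1t) _).trans ?_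
    rw [hc2, mul_assoc]
    gcongr
    refine (eLpNorm_cmul (by simpa using hCC N) _).trans ?_
    rw [mul_assoc]
    gcongr
    have hs := eLpNorm_sum_le (f := fun i x => e2 (-((k - i : ℕ) * (T * r))) * RR (N * r) H i x)
      (s := Finset.range (k + 1)) (p := u) (μ := volume)
      (fun i _ => ((hRm i).const_mul _).aestronglyMeasurable) hu
    have e : (∑ i ∈ Finset.range (k + 1), fun x => e2 (-((k - i : ℕ) * (T * r))) * RR (N * r) H i x)
        = (fun x => ∑ i ∈ Finset.range (k + 1), e2 (-((k - i : ℕ) * (T * r))) * RR (N * r) H i x) := by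
      ext x; simp
    rw [e] at hs
    refine hs.trans ?_
    rw [Finset.mul_sum]
    refine Finset.sum_le_sum fun i _ => ?_
    refine (eLpNorm_cmul (e2_ne_top _) _).trans ?_
    calc _ ≤ e2 (-((k - i : ℕ) * (T * r))) * (kap n (N * r) * ∑' d : ℕ, e2 (-(d * (N * r - n))) * h (i + d)) := by
          gcongr; exact norm_RR hu (by positivity) hHm i
      _ = _ := by ring
  set A : ℕ → ℝ≥0∞ := fun j => e2 (j * (s * r)) * h j with hA
  have hB : ∀ k : ℕ, e2 (k * (s * r)) * eLpNorm (fun x => G k x ^ r) u volume ≤ c2 *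
      ∑ i ∈ Finset.range (k + 1), e2 (-((k - i : ℕ) * ((T - s) * r))) *
        ∑' d : ℕ, e2 (-(d * (N * r - n + s * r))) * A (i + d) := by
    intro k
    refine (mul_le_mul_right (hLp k) _).trans (le_of_eq ?_)
    rw [← mul_assoc, mul_comm _ c2, mul_assoc, Finset.mul_sum]
    congr 1
    refine Finset.sum_congr rfl fun i hi => ?_
    rw [← mul_assoc, ← ENNReal.tsum_mul_left, ← ENNReal.tsum_mul_left]
    refine tsum_congr fun d => ?_
    simp only [hA]
    have hik : i ≤ k := by have := Finset.mem_range.1 hi; omega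
    have em : ∀ a b c : ℝ, ∀ w : ℝ≥0∞, e2 a * (e2 b * (e2 c * w)) = e2 (a + b + c) * w := by
      intro a b c w; rw [e2_add, e2_add]; ring
    rw [em, mul_assoc (e2 _) (e2 _), em]
    congr 2
    push_cast [hik]
    ring
  -- final
  have key : eLpNorm (fun k : ℕ => e2 (k * (s * r)) * eLpNorm (fun x => G k x ^ r) u volume) v Measure.count
      ≤ c3 * eLpNorm A v Measure.count := by
    refine (eLpNorm_mono_e hB).trans ?_
    refine (eLpNorm_cmul hc2t _).trans ?_
    rw [hc3, mul_assoc c2 (gc _ * gc _)]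
    refine mul_le_mul_right ?_ c2
    refine (disc_low hv _ _).trans ?_
    rw [mul_assoc]
    gcongr
    exact disc_up hv A _
  have conv : ∀ W : ℕ → Rn n → ℝ≥0∞,
      eLpNorm (fun k : ℕ => e2 (k * (s * r)) * eLpNorm (fun x => W k x ^ r) u volume) v Measure.count
        = lqSum q (fun k => e2 (k * s) * eLpNorm (W k) p volume) ^ r := by
    intro W
    rw [lqSum_eq q hq, ← eLpNorm_rp hr]
    congr 1
    ext k
    rw [hudef, eLpNorm_rp hr, ENNReal.mul_rpow_of_nonneg _ _ hr.le, e2_rpow, mul_assoc]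
  rw [conv] at key
  have key2 : A = fun k : ℕ => e2 (k * (s * r)) * eLpNorm (fun x => F k x ^ r) u volume := rfl
  rw [key2, conv] at key
  have := ENNReal.rpow_le_rpow key (by positivity : (0 : ℝ) ≤ r⁻¹)
  rw [ENNReal.mul_rpow_of_nonneg _ _ (by positivity), ← ENNReal.rpow_mul, ← ENNReal.rpow_mul,
    mul_inv_cancel₀ hr.ne', ENNReal.rpow_one, ENNReal.rpow_one] at this
  exact this

end Aux

namespace Aux

/-- The increasing family of Schwartz seminorms. -/
def Q {n : ℕ} (N : ℕ) (g : Sch n) : ℝ :=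
  (Finset.Iic (N, N)).sup (schwartzSeminormFamily ℂ (Rn n) ℂ) g

lemma Q_nonneg {n : ℕ} (N : ℕ) (g : Sch n) : 0 ≤ Q N g := apply_nonneg _ _

lemma Q_le {n : ℕ} {N : ℕ} {g : Sch n} {M : ℝ} (hM : 0 ≤ M)
    (h : ∀ k ≤ N, ∀ l ≤ N, ∀ x, ‖x‖ ^ k * ‖iteratedFDeriv ℝ l g x‖ ≤ M) : Q N g ≤ M := by
  refine Seminorm.finset_sup_apply_le hM fun i hi => ?_
  have := Finset.mem_Iic.1 hi
  exact SchwartzMap.seminorm_le_bound ℂ i.1 i.2 g hM (h _ this.1 _ this.2)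

lemma le_Q {n : ℕ} {N k l : ℕ} (hk : k ≤ N) (hl : l ≤ N) (g : Sch n) (x : Rn n) :
    ‖x‖ ^ k * ‖iteratedFDeriv ℝ l g x‖ ≤ Q N g := by
  refine (SchwartzMap.le_seminorm ℂ k l g x).trans ?_
  exact Seminorm.le_finset_sup_apply (p := schwartzSeminormFamily ℂ (Rn n) ℂ) (i := (k, l)) (Finset.mem_Iic.2 ⟨hk, hl⟩)

lemma le_Q' {n : ℕ} {N l : ℕ} (hl : l ≤ N) (g : Sch n) (x : Rn n) :
    (1 + ‖x‖) ^ N * ‖iteratedFDeriv ℝ l g x‖ ≤ 2 ^ N * Q N g :=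
  SchwartzMap.one_add_le_sup_seminorm_apply (𝕜 := ℂ) (m := (N, N)) le_rfl hl g x

lemma Q_mono {n : ℕ} {N M : ℕ} (h : N ≤ M) (g : Sch n) : Q N g ≤ Q M g :=
  Q_le (Q_nonneg _ _) fun _ hk _ hl x => le_Q (hk.trans h) (hl.trans h) g x

lemma Q_add {n : ℕ} (N : ℕ) (f g : Sch n) : Q N (f + g) ≤ Q N f + Q N g := map_add_le_add _ _ _

lemma Q_smul {n : ℕ} (N : ℕ) (c : ℂ) (g : Sch n) : Q N (c • g) = ‖c‖ * Q N g := map_smul_eq_mul _ _ _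

/-- coordinate directions -/
def ev {n : ℕ} (i : Fin n) : Rn n := EuclideanSpace.single i (1 : ℝ)

lemma norm_ev {n : ℕ} (i : Fin n) : ‖ev i‖ = 1 := by simp [ev]

/-- partial derivative on Schwartz functions -/
def pdS {n : ℕ} (i : Fin n) (g : Sch n) : Sch n := LineDeriv.lineDerivOp (ev i) g

lemma pdS_coe {n : ℕ} (i : Fin n) (g : Sch n) : (fun x => pdS i g x) = pd i (fun x => g x) := by
  ext x; exact SchwartzMap.lineDerivOp_apply (ev i) g x

lemma Q_pdS {n : ℕ} (N : ℕ) (i : Fin n) (g : Sch n) : Q N (pdS i g) ≤ Q (N + 1) g := by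
  refine Q_le (Q_nonneg _ _) fun k hk l hl x => ?_
  have e : (pdS i g : Rn n → ℂ) = fun x => (ContinuousLinearMap.apply ℝ ℂ (ev i)) (fderiv ℝ g x) := by
    ext x; exact SchwartzMap.lineDerivOp_apply_eq_fderiv (ev i) g x
  have h1 : ‖iteratedFDeriv ℝ l (pdS i g) x‖ ≤ ‖iteratedFDeriv ℝ (l + 1) g x‖ := by
    rw [e, ← norm_iteratedFDeriv_fderiv]
    have hc : ContDiff ℝ l (fderiv ℝ g) :=
      (g.smooth (l + 1)).fderiv_right (by norm_cast)
    have := (ContinuousLinearMap.apply ℝ ℂ (ev i)).norm_iteratedFDeriv_comp_left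
      (hc.contDiffAt (x := x)) (le_refl (l : WithTop ℕ∞))
    refine this.trans ?_
    have hn : ‖(ContinuousLinearMap.apply ℝ ℂ (ev i))‖ ≤ 1 := by
      refine ContinuousLinearMap.opNorm_le_bound _ (by norm_num) fun A => ?_
      have := A.le_opNorm (ev i)
      rw [norm_ev] at this
      simpa using this
    calc _ ≤ 1 * ‖iteratedFDeriv ℝ l (fderiv ℝ g) x‖ := by gcongr
      _ = _ := one_mul _
  calc _ ≤ ‖x‖ ^ k * ‖iteratedFDeriv ℝ (l + 1) g x‖ := by gcongr
    _ ≤ _ := le_Q (by omega) (by omega) g x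

/-- iterated derivative along a list of directions -/
def dl {n : ℕ} (L : List (Fin n)) (g : Sch n) : Sch n := L.foldr pdS g

/-- list of a multi-index -/
def mlist {n : ℕ} (α : Fin n → ℕ) : List (Fin n) :=
  (List.finRange n).flatMap fun i => List.replicate (α i) i

lemma dl_replicate {n : ℕ} (k : ℕ) (i : Fin n) (g : Sch n) :
    (fun x => dl (List.replicate k i) g x) = (pd i)^[k] (fun x => g x) := by
  induction k with
  | zero => rfl
  | succ k ih =>
    rw [Function.iterate_succ_apply', ← ih, ← pdS_coe]
    rfl

lemma mderiv_eq {n : ℕ} (α : Fin n → ℕ) (g : Sch n) :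
    mderiv α (fun x => g x) = fun x => dl (mlist α) g x := by
  unfold mderiv mlist
  induction List.finRange n with
  | nil => rfl
  | cons i L ih =>
    rw [List.foldr_cons, ih, List.flatMap_cons, ← dl_replicate]
    unfold dl
    rw [List.foldr_append]

lemma Q_dl {n : ℕ} (N : ℕ) (L : List (Fin n)) (g : Sch n) : Q N (dl L g) ≤ Q (N + L.length) g := by
  induction L generalizing N with
  | nil => exact le_rfl
  | cons i L ih =>
    refine (Q_pdS N i (dl L g)).trans ((ih (N + 1)).trans (le_of_eq ?_))
    rw [List.length_cons]; congr 1; omega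

lemma mlist_length {n : ℕ} (α : Fin n → ℕ) : (mlist α).length = mdeg α := by
  simp [mlist, mdeg, List.length_flatMap, List.sum_ofFn, ← List.ofFn_eq_map]

lemma tdist_bound {n : ℕ} {E : Type*} [NormedAddCommGroup E] [NormedSpace ℂ E] (f : TDist n E) :
    ∃ (C : ℝ) (N : ℕ), 0 ≤ C ∧ ∀ φ, ‖f.toFun φ‖ ≤ C * Q N φ := by
  obtain ⟨c, K, L, h⟩ := f.bound
  refine ⟨|c| * ((Fintype.card (Fin n → Fin (L + 1)) : ℝ) * 2 ^ (K + L)), K + L, by positivity, fun φ => ?_⟩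
  refine (h φ).trans ?_
  have h0 : ∀ x : Rn n, (1 + ‖x‖ ^ 2) ^ ((K : ℝ) / 2) *
    (∑ α : Fin n → Fin (L + 1), if mdeg (fun i => (α i : ℕ)) ≤ L
      then ‖mderiv (fun i => (α i : ℕ)) (fun y => φ y) x‖ else 0) ≤
      (Fintype.card (Fin n → Fin (L + 1)) : ℝ) * 2 ^ (K + L) * Q (K + L) φ := by
    intro x
    have hw : (1 + ‖x‖ ^ 2) ^ ((K : ℝ) / 2) ≤ (1 + ‖x‖) ^ K := by
      rw [← Real.rpow_natCast (1 + ‖x‖) K]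
      have : (1 + ‖x‖) ^ (K : ℝ) = ((1 + ‖x‖) ^ 2) ^ ((K : ℝ) / 2) := by
        rw [← Real.rpow_natCast (1 + ‖x‖) 2, ← Real.rpow_mul (by positivity)]
        congr 1; push_cast; ring
      rw [this]
      apply Real.rpow_le_rpow (by positivity) _ (by positivity)
      nlinarith [norm_nonneg x]
    rw [Finset.mul_sum, mul_assoc, ← nsmul_eq_mul, ← Finset.card_univ]
    refine Finset.sum_le_card_nsmul _ _ _ fun α _ => ?_
    have hq := Q_nonneg (K + L) φ
    split_ifs with hα
    · rw [mderiv_eq]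
      have h2 := le_Q' (N := K) (l := 0) (Nat.zero_le _) (dl (mlist fun i => (α i : ℕ)) φ) x
      rw [norm_iteratedFDeriv_zero] at h2
      have h3 := Q_dl K (mlist fun i => (α i : ℕ)) φ
      rw [mlist_length] at h3
      have h4 := Q_mono (N := K + mdeg fun i => (α i : ℕ)) (M := K + L) (by omega) φ
      have h5 : (2 : ℝ) ^ K ≤ 2 ^ (K + L) := pow_le_pow_right₀ (by norm_num) (by omega)
      calc _ ≤ (1 + ‖x‖) ^ K * ‖dl (mlist fun i => (α i : ℕ)) φ x‖ := by gcongr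
        _ ≤ 2 ^ K * Q K (dl (mlist fun i => (α i : ℕ)) φ) := h2
        _ ≤ 2 ^ (K + L) * Q (K + L) φ := by
          have := h3.trans h4
          exact mul_le_mul h5 this (Q_nonneg _ _) (by positivity)
    · rw [mul_zero]; positivity
  have h1 : schSemi K L φ ≤ (Fintype.card (Fin n → Fin (L + 1)) : ℝ) * 2 ^ (K + L) * Q (K + L) φ :=
    ciSup_le h0
  have h2 : 0 ≤ schSemi K L φ := by
    refine Real.iSup_nonneg fun x => ?_
    refine mul_nonneg (by positivity) (Finset.sum_nonneg fun α _ => ?_)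
    split_ifs <;> positivity
  calc c * schSemi K L φ ≤ |c| * schSemi K L φ := by gcongr; exact le_abs_self c
    _ ≤ |c| * ((Fintype.card (Fin n → Fin (L + 1)) : ℝ) * 2 ^ (K + L) * Q (K + L) φ) := by gcongr
    _ = _ := by ring

end Aux

namespace Aux

lemma sr_apply {n : ℕ} (b : Sch n) (w z : Rn n) : shiftReflect b w z = b (w - z) := rfl

lemma D_sr {n : ℕ} (b : Sch n) (l : ℕ) (w z : Rn n) :
    iteratedFDeriv ℝ l (shiftReflect b w) z = (-1 : ℝ) ^ l • iteratedFDeriv ℝ l b (w - z) := by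
  have e : (shiftReflect b w : Rn n → ℂ) = fun z => (fun u => b ((-1 : ℝ) • u)) (z - w) := by
    ext z; simp [sr_apply]
  rw [e, iteratedFDeriv_comp_sub (f := fun u => b ((-1 : ℝ) • u)), iteratedFDeriv_comp_const_smul]
  · simp
  · exact b.smooth l

lemma D_sr_norm {n : ℕ} (b : Sch n) (l : ℕ) (w z : Rn n) :
    ‖iteratedFDeriv ℝ l (shiftReflect b w) z‖ = ‖iteratedFDeriv ℝ l b (w - z)‖ := by
  rw [D_sr, norm_smul]; simp

lemma peetre {n : ℕ} (w z : Rn n) : 1 + ‖z‖ ≤ (1 + ‖w‖) * (1 + ‖w - z‖) := by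
  have h : ‖z‖ ≤ ‖w‖ + ‖w - z‖ := by
    have := norm_sub_norm_le z w
    rw [norm_sub_rev] at this; linarith
  nlinarith [norm_nonneg w, norm_nonneg (w - z), mul_nonneg (norm_nonneg w) (norm_nonneg (w - z))]

lemma Q_le' {n : ℕ} {N : ℕ} {g : Sch n} {M : ℝ} (hM : 0 ≤ M)
    (h : ∀ l ≤ N, ∀ x, (1 + ‖x‖) ^ N * ‖iteratedFDeriv ℝ l g x‖ ≤ M) : Q N g ≤ M := by
  refine Q_le hM fun k hk l hl x => (le_trans ?_ (h l hl x))
  gcongr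
  calc ‖x‖ ^ k ≤ (1 + ‖x‖) ^ k := by gcongr; linarith
    _ ≤ _ := pow_le_pow_right₀ (by linarith [norm_nonneg x]) hk

lemma sr_bound {n : ℕ} (N l : ℕ) (hl : l ≤ N) (b : Sch n) (w z : Rn n) :
    (1 + ‖z‖) ^ N * ‖iteratedFDeriv ℝ l (shiftReflect b w) z‖ ≤ (1 + ‖w‖) ^ N * (2 ^ N * Q N b) := by
  rw [D_sr_norm]
  calc _ ≤ ((1 + ‖w‖) * (1 + ‖w - z‖)) ^ N * ‖iteratedFDeriv ℝ l b (w - z)‖ := by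
        gcongr; exact peetre w z
    _ = (1 + ‖w‖) ^ N * ((1 + ‖w - z‖) ^ N * ‖iteratedFDeriv ℝ l b (w - z)‖) := by rw [mul_pow, mul_assoc]
    _ ≤ _ := mul_le_mul_of_nonneg_left (le_Q' hl b _) (by positivity)

lemma Q_sr {n : ℕ} (N : ℕ) (b : Sch n) (w : Rn n) :
    Q N (shiftReflect b w) ≤ (1 + ‖w‖) ^ N * (2 ^ N * Q N b) := by
  have := Q_nonneg N b
  exact Q_le' (by positivity) fun l hl z => sr_bound N l hl b w z

lemma sr_lip {n : ℕ} (N : ℕ) (b : Sch n) (w w0 : Rn n) (hw : ‖w - w0‖ ≤ 1) :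
    Q N (shiftReflect b w - shiftReflect b w0) ≤
      ((2 + ‖w0‖) ^ N * (2 ^ (N + 1) * Q (N + 1) b)) * ‖w - w0‖ := by
  have hQ := Q_nonneg (N + 1) b
  refine Q_le' (by positivity) fun l hl z => ?_
  have e : iteratedFDeriv ℝ l (shiftReflect b w - shiftReflect b w0 : Sch n) z =
      (-1 : ℝ) ^ l • (iteratedFDeriv ℝ l b (w - z) - iteratedFDeriv ℝ l b (w0 - z)) := by
    have : ((shiftReflect b w - shiftReflect b w0 : Sch n) : Rn n → ℂ) =
      (shiftReflect b w : Rn n → ℂ) - (shiftReflect b w0 : Rn n → ℂ) := rfl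
    rw [this, iteratedFDeriv_sub_apply, D_sr, D_sr, smul_sub]
    · exact ((shiftReflect b w).smooth l).contDiffAt
    · exact ((shiftReflect b w0).smooth l).contDiffAt
  rw [e, norm_smul]
  simp only [norm_pow, norm_neg, norm_one, one_pow, one_mul]
  have hz : 0 < 1 + ‖z‖ := by positivity
  have hseg : ∀ ζ ∈ segment ℝ (w0 - z) (w - z), ‖fderiv ℝ (iteratedFDeriv ℝ l b) ζ‖ ≤
      ((2 + ‖w0‖) ^ N * (2 ^ (N + 1) * Q (N + 1) b)) / (1 + ‖z‖) ^ N := by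
    intro ζ hζ
    rw [norm_fderiv_iteratedFDeriv, le_div_iff₀ (by positivity), mul_comm]
    have hd : ‖ζ - (w0 - z)‖ ≤ 1 := by
      have h1 := norm_sub_le_of_mem_segment hζ
      simp only [sub_sub_sub_cancel_right] at h1
      linarith
    have hp := peetre (ζ + z) z
    have h2 : ‖ζ + z‖ ≤ ‖w0‖ + 1 := by
      have := norm_add_le (ζ - (w0 - z)) w0
      have e2 : ζ - (w0 - z) + w0 = ζ + z := by abel
      rw [e2] at this; linarith
    rw [add_sub_cancel_right] at hp
    have h3 : 1 + ‖z‖ ≤ (2 + ‖w0‖) * (1 + ‖ζ‖) :=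
      hp.trans (mul_le_mul_of_nonneg_right (by linarith) (by positivity))
    calc _ ≤ ((2 + ‖w0‖) * (1 + ‖ζ‖)) ^ N * ‖iteratedFDeriv ℝ (l + 1) b ζ‖ := by gcongr
      _ = (2 + ‖w0‖) ^ N * ((1 + ‖ζ‖) ^ N * ‖iteratedFDeriv ℝ (l + 1) b ζ‖) := by rw [mul_pow, mul_assoc]
      _ ≤ (2 + ‖w0‖) ^ N * ((1 + ‖ζ‖) ^ (N + 1) * ‖iteratedFDeriv ℝ (l + 1) b ζ‖) := by
          gcongr
          · linarith [norm_nonneg ζ]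
          · omega
      _ ≤ _ := mul_le_mul_of_nonneg_left (le_Q' (by omega) b ζ) (by positivity)
  have hdiff : ∀ ζ ∈ segment ℝ (w0 - z) (w - z), DifferentiableAt ℝ (iteratedFDeriv ℝ l b) ζ :=
    fun ζ _ => ((b.smooth (l + 1)).differentiable_iteratedFDeriv (by norm_cast; omega)) ζ
  have := Convex.norm_image_sub_le_of_norm_fderiv_le hdiff hseg (convex_segment _ _)
    (left_mem_segment ℝ _ _) (right_mem_segment ℝ _ _)
  rw [sub_sub_sub_cancel_right] at this
  calc _ ≤ (1 + ‖z‖) ^ N * (((2 + ‖w0‖) ^ N * (2 ^ (N + 1) * Q (N + 1) b)) / (1 + ‖z‖) ^ N * ‖w - w0‖) := by gcongr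
    _ = _ := by field_simp

lemma sr_tendsto {n : ℕ} (N : ℕ) (b : Sch n) (w0 : Rn n) :
    Tendsto (fun w => Q N (shiftReflect b w - shiftReflect b w0)) (𝓝 w0) (𝓝 0) := by
  refine squeeze_zero' (Eventually.of_forall fun w => Q_nonneg _ _)
    (g := fun w => ((2 + ‖w0‖) ^ N * (2 ^ (N + 1) * Q (N + 1) b)) * ‖w - w0‖) ?_ ?_
  · filter_upwards [Metric.closedBall_mem_nhds w0 one_pos] with w hw
    exact sr_lip N b w w0 (by simpa [dist_eq_norm] using hw)
  · have : Continuous fun w : Rn n => ((2 + ‖w0‖) ^ N * (2 ^ (N + 1) * Q (N + 1) b)) * ‖w - w0‖ := by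
      fun_prop
    have h := this.tendsto w0
    simpa using h

lemma continuous_sr {n : ℕ} {X : Type*} [SeminormedAddCommGroup X] [NormedSpace ℂ X]
    (J : Sch n →ₗ[ℂ] X) (C : ℝ) (N : ℕ) (h : ∀ φ, ‖J φ‖ ≤ C * Q N φ) (b : Sch n) :
    Continuous fun w => J (shiftReflect b w) := by
  rw [continuous_iff_continuousAt]
  intro w0
  rw [ContinuousAt, tendsto_iff_norm_sub_tendsto_zero]
  refine squeeze_zero (fun w => norm_nonneg _) (fun w => ?_)
    (g := fun w => C * Q N (shiftReflect b w - shiftReflect b w0)) ?_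
  · rw [← map_sub]; exact h _
  · simpa using (sr_tendsto N b w0).const_mul C

lemma mOp_continuous {n : ℕ} {E : Type*} [NormedAddCommGroup E] [NormedSpace ℂ E]
    (a : Sch n) (f : TDist n E) : Continuous (mOp a f) := by
  obtain ⟨C, N, hC, h⟩ := tdist_bound f
  exact (continuous_sr f.toFun C N h _).const_smul _

/-- index type of the embedding -/
abbrev II (n N : ℕ) : Type := Rn n × (Σ l : Fin (N + 1), (Fin l → Rn n))

/-- the target type of the embedding -/
abbrev XX (n N : ℕ) : Type := lp (fun _ : II n N => ℂ) ∞

/-- weight -/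
def wt {n N : ℕ} (i : II n N) : ℂ := (((1 + ‖i.1‖) ^ N * (∏ j, ‖i.2.2 j‖)⁻¹ : ℝ) : ℂ)

/-- components -/
def jj {n N : ℕ} (φ : Sch n) (i : II n N) : ℂ :=
  wt i * iteratedFDeriv ℝ i.2.1 φ i.1 i.2.2

lemma JJ_aux {n : ℕ} (N : ℕ) (φ : Sch n) (i : II n N) : ‖jj φ i‖ ≤ 2 ^ N * Q N φ := by
  have hQ := Q_nonneg N φ
  have h1 := le_Q' (N := N) (l := i.2.1) (by omega) φ i.1
  have h2 := (iteratedFDeriv ℝ i.2.1 φ i.1).le_opNorm i.2.2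
  unfold jj wt
  rw [norm_mul, Complex.norm_of_nonneg (by positivity)]
  by_cases h0 : ∏ j, ‖i.2.2 j‖ = 0
  · rw [h0]; simp; positivity
  · have hp : 0 < ∏ j, ‖i.2.2 j‖ := lt_of_le_of_ne (by positivity) (Ne.symm h0)
    calc _ ≤ (1 + ‖i.1‖) ^ N * (∏ j, ‖i.2.2 j‖)⁻¹ * (‖iteratedFDeriv ℝ i.2.1 φ i.1‖ * ∏ j, ‖i.2.2 j‖) := by
          gcongr
      _ = (1 + ‖i.1‖) ^ N * ‖iteratedFDeriv ℝ i.2.1 φ i.1‖ := by field_simp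
      _ ≤ _ := h1

/-- the embedding -/
def JJ {n : ℕ} (N : ℕ) : Sch n →ₗ[ℂ] XX n N where
  toFun φ := ⟨fun i => jj φ i, memℓp_infty ⟨2 ^ N * Q N φ, by
    rintro _ ⟨i, rfl⟩; exact JJ_aux N φ i⟩⟩
  map_add' φ ψ := by
    ext i
    have : iteratedFDeriv ℝ i.2.1 (φ + ψ : Sch n) i.1 =
        iteratedFDeriv ℝ i.2.1 φ i.1 + iteratedFDeriv ℝ i.2.1 ψ i.1 :=
      iteratedFDeriv_add_apply (φ.smooth _).contDiffAt (ψ.smooth _).contDiffAt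
    change jj (φ + ψ) i = jj φ i + jj ψ i
    unfold jj
    rw [this, ← mul_add]; rfl
  map_smul' c φ := by
    ext i
    have : iteratedFDeriv ℝ i.2.1 (c • φ : Sch n) i.1 = c • iteratedFDeriv ℝ i.2.1 φ i.1 :=
      iteratedFDeriv_const_smul_apply (φ.smooth _).contDiffAt
    change jj (c • φ) i = c * jj φ i
    unfold jj
    rw [this, mul_left_comm]; rfl

lemma JJ_apply {n : ℕ} (N : ℕ) (φ : Sch n) (i : II n N) : (JJ N φ : II n N → ℂ) i = jj φ i := rfl

lemma JJ_le {n : ℕ} (N : ℕ) (φ : Sch n) : ‖JJ N φ‖ ≤ 2 ^ N * Q N φ := by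
  have := Q_nonneg N φ
  exact lp.norm_le_of_forall_le (by positivity) (JJ_aux N φ)

lemma le_JJ {n : ℕ} (N : ℕ) (φ : Sch n) : Q N φ ≤ ‖JJ N φ‖ := by
  refine Q_le' (norm_nonneg _) fun l hl z => ?_
  have hz : 0 < (1 + ‖z‖) ^ N := by positivity
  rw [mul_comm, ← le_div_iff₀ hz]
  refine ContinuousMultilinearMap.opNorm_le_bound (by positivity) fun m => ?_
  have h1 := lp.norm_apply_le_norm ENNReal.top_ne_zero (JJ N φ) (z, ⟨⟨l, by omega⟩, m⟩)
  rw [JJ_apply] at h1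
  unfold jj wt at h1
  rw [norm_mul, Complex.norm_of_nonneg (by positivity)] at h1
  by_cases h0 : ∏ j, ‖m j‖ = 0
  · obtain ⟨j, -, hj⟩ := Finset.prod_eq_zero_iff.1 h0
    rw [(iteratedFDeriv ℝ l φ z).map_coord_zero j (norm_eq_zero.1 hj), h0]
    simp
  · have hp : 0 < ∏ j, ‖m j‖ := lt_of_le_of_ne (by positivity) (Ne.symm h0)
    rw [div_mul_eq_mul_div, le_div_iff₀ hz, ← div_le_iff₀ hp]
    refine le_trans (le_of_eq ?_) h1
    simp only [div_eq_mul_inv]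
    ring

lemma JJ_inj {n : ℕ} (N : ℕ) : Function.Injective (JJ (n := n) N) := by
  rw [injective_iff_map_eq_zero]
  intro φ h
  have h1 := le_JJ N φ
  rw [h, norm_zero] at h1
  ext z
  have h2 := le_Q (N := N) (k := 0) (l := 0) (by omega) (by omega) φ z
  rw [pow_zero, one_mul, norm_iteratedFDeriv_zero] at h2
  exact norm_le_zero_iff.1 (h2.trans h1)

lemma extend {n : ℕ} (N : ℕ) (T : Sch n →ₗ[ℂ] ℂ) (C : ℝ) (hC : 0 ≤ C) (h : ∀ φ, ‖T φ‖ ≤ C * Q N φ) :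
    ∃ T' : XX n N →L[ℂ] ℂ, ∀ φ, T' (JJ N φ) = T φ := by
  let eqv := LinearEquiv.ofInjective (JJ (n := n) N) (JJ_inj N)
  let T0 : LinearMap.range (JJ (n := n) N) →ₗ[ℂ] ℂ := T ∘ₗ eqv.symm.toLinearMap
  have hT0 : ∀ φ, T0 (eqv φ) = T φ := fun φ => by simp [T0]
  let T1 : StrongDual ℂ (LinearMap.range (JJ (n := n) N)) := T0.mkContinuous C (by
    intro x
    obtain ⟨φ, rfl⟩ := eqv.surjective x
    rw [hT0]
    refine (h φ).trans ?_
    gcongr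
    exact le_JJ N φ)
  obtain ⟨g, hg, -⟩ := exists_extension_norm_eq _ T1
  refine ⟨g, fun φ => ?_⟩
  have := hg (eqv φ)
  rw [← hT0 φ]
  exact this

end Aux

namespace Aux
open LineDeriv

/-- pointwise product of Schwartz functions -/
def mulS {n : ℕ} (m a : Sch n) : Sch n := SchwartzMap.pairing (ContinuousLinearMap.mul ℂ ℂ) m a

lemma mulS_apply {n : ℕ} (m a : Sch n) (x : Rn n) : mulS m a x = m x * a x := rfl

lemma invF_eq {n : ℕ} (a : Sch n) : invFourierS a = 𝓕⁻ a := rfl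

lemma conv0 {n : ℕ} (m a : Sch n) (x : Rn n) :
    invFourierS (mulS m a) x = ∫ y, invFourierS m y * invFourierS a (x - y) := by
  have h := SchwartzMap.convolution_apply (ContinuousLinearMap.mul ℂ ℂ) (𝓕⁻ m) (𝓕⁻ a) x
  have e : SchwartzMap.convolution (ContinuousLinearMap.mul ℂ ℂ) (𝓕⁻ m) (𝓕⁻ a) = 𝓕⁻ (mulS m a) := by
    simp [SchwartzMap.convolution, mulS]
  rw [e] at h
  exact h

lemma conv1 {n : ℕ} (l : ℕ) (m a : Sch n) (v : Fin l → Rn n) (x : Rn n) :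
    (∂^{v} (invFourierS (mulS m a)) : Sch n) x = ∫ y, invFourierS m y * (∂^{v} (invFourierS a) : Sch n) (x - y) := by
  induction l generalizing a with
  | zero => exact conv0 m a x
  | succ l ih =>
    simp only [iteratedLineDerivOp_succ_right, invF_eq] at ih ⊢
    have hg : (fun y : Rn n => inner ℝ y (v (Fin.last l))).HasTemperateGrowth := by fun_prop
    have key : ∂_{v (Fin.last l)} (𝓕⁻ (mulS m a)) =
        𝓕⁻ (mulS m ((2 * π * Complex.I) • smulLeftCLM ℂ (inner ℝ · (v (Fin.last l))) a)) := by
      rw [lineDerivOp_fourierInv_eq]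
      congr 1
      ext y
      simp only [SchwartzMap.smul_apply, smulLeftCLM_apply_apply hg, mulS_apply, smul_eq_mul, Complex.real_smul]
      ring
    rw [key, lineDerivOp_fourierInv_eq]
    exact ih _ _

lemma conv2 {n : ℕ} (N : ℕ) (m a : Sch n) (x : Rn n) (i : II n N) :
    jj (shiftReflect (invFourierS (mulS m a)) x) i =
      ∫ y, invFourierS m y * jj (shiftReflect (invFourierS a) (x - y)) i := by
  obtain ⟨z, l, v⟩ := i
  have h := conv1 l m a v (x - z)
  simp only [iteratedLineDerivOp_eq_iteratedFDeriv] at h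
  have e : ∀ (b : Sch n) (w : Rn n), jj (N := N) (shiftReflect b w) (z, ⟨l, v⟩) =
      (wt (N := N) (z, ⟨l, v⟩) * (-1 : ℂ) ^ (l : ℕ)) * iteratedFDeriv ℝ l b (w - z) v := by
    intro b w
    unfold jj
    simp only [D_sr]
    change _ * ((-1 : ℝ) ^ (l : ℕ) • (iteratedFDeriv ℝ l b (w - z) v : ℂ)) = _
    rw [Complex.real_smul]
    push_cast
    ring
  simp only [e]
  rw [h, ← integral_const_mul]
  congr 1
  ext y
  rw [sub_right_comm]
  ring

lemma int_aux {n : ℕ} (N : ℕ) (g b : Sch n) (x : Rn n) :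
    Integrable (fun y => g y • JJ N (shiftReflect b (x - y))) := by
  have hc : Continuous fun w => JJ N (shiftReflect b w) :=
    continuous_sr (JJ N) (2 ^ N) N (JJ_le N) b
  have hc2 : Continuous fun y => JJ N (shiftReflect b (x - y)) := hc.comp (by fun_prop)
  have hQ := Q_nonneg N b
  obtain ⟨k, hk⟩ : ∃ k : ℕ, Integrable (fun y : Rn n => (1 + ‖y‖) ^ (-(k : ℝ))) := by
    refine ⟨n + 1, integrable_one_add_norm ?_⟩
    simp
  let M := (2 ^ N * ((1 + ‖x‖) ^ N * (2 ^ N * Q N b))) * (2 ^ (N + k) * Q (N + k) g)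
  refine Integrable.mono' (hk.const_mul M) (by
    have := g.continuous
    exact (this.smul hc2).aestronglyMeasurable) (Eventually.of_forall fun y => ?_)
  rw [norm_smul]
  have h1 : ‖JJ N (shiftReflect b (x - y))‖ ≤ 2 ^ N * ((1 + ‖x‖) ^ N * (1 + ‖y‖) ^ N * (2 ^ N * Q N b)) := by
    refine (JJ_le N _).trans (mul_le_mul_of_nonneg_left ((Q_sr N b _).trans ?_) (by positivity))
    refine mul_le_mul_of_nonneg_right ?_ (by positivity)
    rw [← mul_pow]
    gcongr
    have := norm_sub_le x y
    nlinarith [mul_nonneg (norm_nonneg x) (norm_nonneg y)]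
  have h2 := le_Q' (N := N + k) (l := 0) (by omega) g y
  rw [norm_iteratedFDeriv_zero] at h2
  have hy : 0 < 1 + ‖y‖ := by positivity
  rw [Real.rpow_neg hy.le, Real.rpow_natCast]
  calc _ ≤ ‖g y‖ * (2 ^ N * ((1 + ‖x‖) ^ N * (1 + ‖y‖) ^ N * (2 ^ N * Q N b))) := by gcongr
    _ = (2 ^ N * ((1 + ‖x‖) ^ N * (2 ^ N * Q N b))) * ((1 + ‖y‖) ^ (N + k) * ‖g y‖) * ((1 + ‖y‖) ^ k)⁻¹ := by
        rw [pow_add]; field_simp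
    _ ≤ _ := by
        refine mul_le_mul_of_nonneg_right (mul_le_mul_of_nonneg_left h2 (by positivity)) (by positivity)

lemma conv3 {n : ℕ} (N : ℕ) (m a : Sch n) (x : Rn n) :
    JJ N (shiftReflect (invFourierS (mulS m a)) x) =
      ∫ y, invFourierS m y • JJ N (shiftReflect (invFourierS a) (x - y)) := by
  ext i
  have := (lp.evalCLM ℂ (fun _ : II n N => ℂ) ∞ i).integral_comp_comm (int_aux N (invFourierS m) (invFourierS a) x)
  exact (conv2 N m a x i).trans this

lemma conv4 {n : ℕ} (T : Sch n →ₗ[ℂ] ℂ) (C : ℝ) (N : ℕ) (hC : 0 ≤ C) (h : ∀ φ, ‖T φ‖ ≤ C * Q N φ)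
    (m a : Sch n) (x : Rn n) :
    T (shiftReflect (invFourierS (mulS m a)) x) =
      ∫ y, invFourierS m y * T (shiftReflect (invFourierS a) (x - y)) := by
  obtain ⟨T', hT⟩ := extend N T C hC h
  simp only [← hT]
  rw [conv3, ← T'.integral_comp_comm (int_aux N _ _ x)]
  simp

lemma conv_ineq {n : ℕ} {E : Type*} [NormedAddCommGroup E] [NormedSpace ℂ E] (m a : Sch n) (f : TDist n E)
    (x : Rn n) : ‖mOp (mulS m a) f x‖ₑ ≤ ∫⁻ z, ‖invFourierS m (x - z)‖ₑ * ‖mOp a f z‖ₑ := by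
  obtain ⟨C, N, hC, hf⟩ := tdist_bound f
  obtain ⟨e, he, heq⟩ := exists_dual_vector'' ℂ (mOp (mulS m a) f x)
  have h0 : ‖mOp (mulS m a) f x‖ₑ = ‖e (mOp (mulS m a) f x)‖ₑ := by rw [heq]; simp [enorm_eq_nnnorm]
  have hle : ∀ u, ‖e u‖ ≤ ‖u‖ := fun u => by
    refine (e.le_opNorm u).trans ?_
    calc _ ≤ 1 * ‖u‖ := by gcongr
      _ = _ := one_mul _
  have h1 := conv4 ((e : E →ₗ[ℂ] ℂ) ∘ₗ f.toFun) C N hC (fun φ => (hle _).trans (hf φ)) m a x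
  have h2 : e (mOp (mulS m a) f x) = ∫ y, invFourierS m y * e (mOp a f (x - y)) := by
    unfold mOp tdConv
    have hsm : ∀ (c : ℝ) (u : E), e (c • u) = (c : ℂ) * e u := by
      intro c u
      rw [← Complex.coe_smul, map_smul, smul_eq_mul]
    simp only [hsm]
    simp only [LinearMap.comp_apply, ContinuousLinearMap.coe_coe] at h1
    rw [h1, ← integral_const_mul]
    congr 1; ext y; ring
  rw [h0, h2]
  refine (enorm_integral_le_lintegral_enorm _).trans ?_
  rw [← lintegral_sub_left_eq_self _ x]
  refine lintegral_mono fun y => ?_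
  simp only [sub_sub_cancel]
  rw [enorm_mul]
  gcongr
  exact enorm_le_iff_norm_le.2 (hle _)

end Aux

namespace Aux

lemma fourier_bound {n : ℕ} (N : ℕ) : ∃ (C : ℝ) (N' : ℕ), 0 ≤ C ∧ ∀ m : Sch n,
    Q N (invFourierS m) ≤ C * Q N' m := by
  let p : Seminorm ℂ (Sch n) := (((Finset.Iic (N, N)).sup (schwartzSeminormFamily ℂ (Rn n) ℂ))).comp
    ((FourierTransform.fourierCLE ℂ (Sch n)).symm : Sch n →L[ℂ] Sch n).toLinearMap
  have hp : Continuous p := by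
    have h1 : Continuous ((Finset.Iic (N, N)).sup (schwartzSeminormFamily ℂ (Rn n) ℂ) : Seminorm ℂ (Sch n)) := by
      refine Seminorm.continuous_of_le ?_ (Seminorm.finset_sup_le_sum (schwartzSeminormFamily ℂ (Rn n) ℂ) (Finset.Iic (N, N)))
      have : Continuous fun x : Sch n => ∑ i ∈ Finset.Iic (N, N), schwartzSeminormFamily ℂ (Rn n) ℂ i x :=
        continuous_finsetSum _ fun i _ => (schwartz_withSeminorms ℂ (Rn n) ℂ).continuous_seminorm i
      convert this using 1
      ext x; simp
    exact h1.comp (FourierTransform.fourierCLE ℂ (Sch n)).symm.continuous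
  obtain ⟨s, C, hC, h⟩ := Seminorm.bound_of_continuous (schwartz_withSeminorms ℂ (Rn n) ℂ) p hp
  refine ⟨C, s.sup (fun i => max i.1 i.2), C.2, fun m => ?_⟩
  refine (h m).trans ?_
  rw [Seminorm.smul_apply, NNReal.smul_def, smul_eq_mul]
  refine mul_le_mul_of_nonneg_left ?_ C.2
  refine Seminorm.finset_sup_apply_le (Q_nonneg _ _) fun i hi => ?_
  have hi' := Finset.le_sup (f := fun i : ℕ × ℕ => max i.1 i.2) hi
  exact SchwartzMap.seminorm_le_bound ℂ i.1 i.2 m (Q_nonneg _ _) fun x =>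
    le_Q ((le_max_left _ _).trans hi') ((le_max_right _ _).trans hi') m x

lemma dilate_apply {n : ℕ} (m : Sch n) {t : ℝ} (ht : t ≠ 0) (x : Rn n) : dilate m t x = m (t • x) := by
  unfold dilate
  rw [dif_neg ht]; rfl

lemma invF_dilate {n : ℕ} (m : Sch n) {t : ℝ} (ht : 0 < t) (y : Rn n) :
    invFourierS m y = (t : ℂ) ^ n * invFourierS (dilate m t) (t • y) := by
  rw [invF_eq, invF_eq, fourierInv_coe, fourierInv_coe, Real.fourierInv_eq, Real.fourierInv_eq]
  have := Measure.integral_comp_smul volume (fun v : Rn n => Real.fourierChar (inner ℝ v y) • m v) t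
  simp only [dilate_apply m ht.ne']
  simp only [inner_smul_left, inner_smul_right] at this ⊢
  simp only [conj_trivial] at this
  rw [this]
  simp only [finrank_euclideanSpace, Fintype.card_fin]
  rw [abs_of_pos (by positivity), Complex.real_smul]
  push_cast
  have : (t : ℂ) ≠ 0 := by exact_mod_cast ht.ne'
  field_simp

lemma kernel_bound {n : ℕ} (N : ℕ) : ∃ (C : ℝ) (N' : ℕ), 0 ≤ C ∧ ∀ (m : Sch n) (k : ℕ) (y : Rn n),
    ‖invFourierS m y‖ₑ ≤ ENNReal.ofReal (C * Q N' (dilate m (2 ^ k))) * (e2 (k * n) * V k 0 y ^ N) := by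
  obtain ⟨C, N', hC, h⟩ := fourier_bound (n := n) N
  refine ⟨2 ^ N * C, N', by positivity, fun m k y => ?_⟩
  have h1 := invF_dilate m (t := 2 ^ k) (by positivity) y
  have h2 := le_Q' (N := N) (l := 0) (Nat.zero_le _) (invFourierS (dilate m (2 ^ k))) ((2 : ℝ) ^ k • y)
  rw [norm_iteratedFDeriv_zero, norm_smul, norm_pow, Real.norm_ofNat] at h2
  have h3 := h (dilate m (2 ^ k))
  have hpos : 0 < (1 + 2 ^ k * ‖y‖) ^ N := by positivity
  have h4 : ‖invFourierS m y‖ ≤ (2 ^ N * C * Q N' (dilate m (2 ^ k))) * ((2 ^ ((k : ℝ) * n)) * ((1 + 2 ^ k * ‖y‖) ^ N)⁻¹) := by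
    rw [h1, norm_mul, norm_pow, Complex.norm_real, norm_pow, Real.norm_ofNat]
    have e : (2 : ℝ) ^ ((k : ℝ) * n) = (2 ^ k) ^ n := by
      rw [← pow_mul, ← Real.rpow_natCast]; push_cast; rfl
    rw [e]
    have h5 : ‖invFourierS (dilate m (2 ^ k)) ((2 : ℝ) ^ k • y)‖ ≤ 2 ^ N * C * Q N' (dilate m (2 ^ k)) * ((1 + 2 ^ k * ‖y‖) ^ N)⁻¹ := by
      rw [← div_eq_mul_inv, le_div_iff₀ hpos, mul_comm]
      refine h2.trans ?_
      rw [mul_assoc]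
      exact mul_le_mul_of_nonneg_left h3 (by positivity)
    calc _ ≤ ((2 : ℝ) ^ k) ^ n * (2 ^ N * C * Q N' (dilate m (2 ^ k)) * ((1 + 2 ^ k * ‖y‖) ^ N)⁻¹) :=
          mul_le_mul_of_nonneg_left h5 (by positivity)
      _ = _ := by ring
  have hQ := Q_nonneg N' (dilate m (2 ^ k))
  rw [← ofReal_norm]
  refine (ENNReal.ofReal_le_ofReal h4).trans (le_of_eq ?_)
  rw [ENNReal.ofReal_mul (by positivity)]
  congr 1
  rw [ENNReal.ofReal_mul (by positivity), e2_ofReal, ENNReal.ofReal_inv_of_pos hpos, V, pow_zero, one_mul, ENNReal.ofReal_pow (by positivity), ENNReal.inv_pow]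

/-- linear version of mOp -/
def mOpL {n : ℕ} {E : Type*} [NormedAddCommGroup E] [NormedSpace ℂ E] (f : TDist n E) (x : Rn n) :
    Sch n →ₗ[ℂ] E where
  toFun a := mOp a f x
  map_add' a b := by
    have h1 : invFourierS (a + b) = invFourierS a + invFourierS b := map_add _ _ _
    have h2 : shiftReflect (invFourierS a + invFourierS b) x =
      shiftReflect (invFourierS a) x + shiftReflect (invFourierS b) x := map_add _ _ _
    unfold mOp tdConv
    rw [h1, h2, map_add, smul_add]
  map_smul' c a := by
    have h1 : invFourierS (c • a) = c • invFourierS a := map_smul _ _ _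
    have h2 : shiftReflect (c • invFourierS a) x = c • shiftReflect (invFourierS a) x := by
      ext z; rfl
    unfold mOp tdConv
    rw [h1, h2, map_smul, smul_comm, RingHom.id_apply]

lemma mOpL_apply {n : ℕ} {E : Type*} [NormedAddCommGroup E] [NormedSpace ℂ E] (f : TDist n E) (x : Rn n)
    (a : Sch n) : mOpL f x a = mOp a f x := rfl

lemma mOp_bound {n : ℕ} {E : Type*} [NormedAddCommGroup E] [NormedSpace ℂ E] (f : TDist n E) :
    ∃ (C : ℝ) (N N' : ℕ), 0 ≤ C ∧ ∀ a x, ‖mOp a f x‖ ≤ C * (1 + ‖x‖) ^ N * Q N' a := by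
  obtain ⟨C, N, hC, hf⟩ := tdist_bound f
  obtain ⟨C1, N1, hC1, h1⟩ := fourier_bound (n := n) N
  refine ⟨(2 * π) ^ (-(n : ℝ) / 2) * (C * (2 ^ N * C1)), N, N1, by positivity, fun a x => ?_⟩
  unfold mOp tdConv
  rw [norm_smul, Real.norm_of_nonneg (by positivity)]
  have h2 := Q_sr N (invFourierS a) x
  have h3 := h1 a
  calc _ ≤ ((2 * π) ^ (-(n : ℝ) / 2)) * (C * ((1 + ‖x‖) ^ N * (2 ^ N * (C1 * Q N1 a)))) := by
        refine mul_le_mul_of_nonneg_left ((hf _).trans (mul_le_mul_of_nonneg_left (h2.trans ?_) hC)) (by positivity)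
        gcongr
    _ = _ := by ring

/-- expansion of multipliers -/
structure Expd {n : ℕ} (T : ℝ) (a b : ℕ → Sch n) (m : ℕ → ℕ → Sch n) : Prop where
  conv : ∀ k N, Tendsto (fun J => Q N (b k - ∑ i ∈ Finset.range J, mulS (m k i) (a i))) atTop (𝓝 0)
  high : ∀ N P : ℕ, ∃ C : ℝ, ∀ k d : ℕ, Q N (dilate (m k (k + d)) (2 ^ k)) ≤ C * ((2 ^ d) ^ P)⁻¹
  low : ∀ N : ℕ, ∃ C : ℝ, ∀ i d : ℕ, 0 < d → Q N (dilate (m (i + d) i) (2 ^ i)) ≤ C * 2 ^ (-((d : ℝ) * T))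

lemma expd_point {n : ℕ} {E : Type*} [NormedAddCommGroup E] [NormedSpace ℂ E] {T : ℝ} {a b : ℕ → Sch n}
    {m : ℕ → ℕ → Sch n} (h : Expd T a b m) (f : TDist n E) (k : ℕ) (x : Rn n) :
    ‖mOp (b k) f x‖ₑ ≤ ∑' i, ∫⁻ z, ‖invFourierS (m k i) (x - z)‖ₑ * ‖mOp (a i) f z‖ₑ := by
  obtain ⟨C, N, N', hC, hb⟩ := mOp_bound f
  have hlim : Tendsto (fun J => (∑' i, ∫⁻ z, ‖invFourierS (m k i) (x - z)‖ₑ * ‖mOp (a i) f z‖ₑ) +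
      ENNReal.ofReal (C * (1 + ‖x‖) ^ N * Q N' (b k - ∑ i ∈ Finset.range J, mulS (m k i) (a i)))) atTop
      (𝓝 ((∑' i, ∫⁻ z, ‖invFourierS (m k i) (x - z)‖ₑ * ‖mOp (a i) f z‖ₑ) + 0)) := by
    refine tendsto_const_nhds.add ?_
    rw [← ENNReal.ofReal_zero]
    refine ENNReal.tendsto_ofReal ?_
    simpa using (h.conv k N').const_mul (C * (1 + ‖x‖) ^ N)
  rw [add_zero] at hlim
  refine ge_of_tendsto' hlim fun J => ?_
  set r := b k - ∑ i ∈ Finset.range J, mulS (m k i) (a i) with hr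
  have e : b k = (∑ i ∈ Finset.range J, mulS (m k i) (a i)) + r := by rw [hr]; abel
  have e2 : mOp (b k) f x = (∑ i ∈ Finset.range J, mOp (mulS (m k i) (a i)) f x) + mOp r f x := by
    have := congrArg (mOpL f x) e
    rw [map_add, map_sum] at this
    exact this
  rw [e2]
  refine (enorm_add_le _ _).trans (add_le_add ?_ ?_)
  · refine (enorm_sum_le _ _).trans ((Finset.sum_le_sum fun i _ => conv_ineq _ _ f x).trans ?_)
    exact ENNReal.sum_le_tsum _
  · rw [← ofReal_norm]
    exact ENNReal.ofReal_le_ofReal (hb _ _)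

end Aux

namespace Aux

lemma V_d {n : ℕ} (k d : ℕ) (y : Rn n) : V k d y = ENNReal.ofReal (((2 : ℝ) ^ d)⁻¹) * V k 0 y := by
  unfold V
  rw [pow_zero, one_mul, ENNReal.ofReal_mul (by positivity), ENNReal.ofReal_inv_of_pos (by positivity),
    ENNReal.mul_inv (Or.inr ENNReal.ofReal_ne_top) (Or.inl ENNReal.ofReal_ne_top)]

lemma expd_high {n : ℕ} {T : ℝ} {a b : ℕ → Sch n} {m : ℕ → ℕ → Sch n} (h : Expd T a b m) (N : ℕ) :
    ∃ C : ℝ≥0∞, C ≠ ∞ ∧ ∀ (F : ℕ → Rn n → ℝ≥0∞) (k d : ℕ) (x : Rn n),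
      ∫⁻ z, ‖invFourierS (m k (k + d)) (x - z)‖ₑ * F (k + d) z ≤
        C * ∫⁻ z, e2 ((k + d : ℕ) * n) * V k d (x - z) ^ (N : ℝ) * F (k + d) z := by
  obtain ⟨C1, N', hC1, hk⟩ := kernel_bound (n := n) N
  obtain ⟨C2, h2⟩ := h.high N' N
  refine ⟨ENNReal.ofReal (C1 * C2), ENNReal.ofReal_ne_top, fun F k d x => ?_⟩
  rw [← lintegral_const_mul' _ _ ENNReal.ofReal_ne_top]
  refine lintegral_mono fun z => ?_
  rw [← mul_assoc]
  refine mul_le_mul_left ?_ _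
  refine (hk _ k _).trans ?_
  have hC2 : 0 ≤ C2 := by
    have := (Q_nonneg _ _).trans (h2 0 0)
    simpa using this
  calc _ ≤ ENNReal.ofReal (C1 * (C2 * ((2 ^ d) ^ N)⁻¹)) * (e2 ((k + d : ℕ) * n) * V k 0 (x - z) ^ N) := by
        gcongr
        · exact h2 k d
        · exact e2_mono (by push_cast; nlinarith [Nat.cast_nonneg (α := ℝ) d, Nat.cast_nonneg (α := ℝ) n])
    _ = _ := by
        rw [V_d k d, ENNReal.rpow_natCast, mul_pow, ← ENNReal.ofReal_pow (by positivity), ← mul_assoc C1,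
          ENNReal.ofReal_mul (by positivity), inv_pow]
        ring

lemma expd_low {n : ℕ} {T : ℝ} {a b : ℕ → Sch n} {m : ℕ → ℕ → Sch n} (h : Expd T a b m) (N : ℕ) :
    ∃ C : ℝ≥0∞, C ≠ ∞ ∧ ∀ (F : ℕ → Rn n → ℝ≥0∞) (k i : ℕ) (x : Rn n), i < k → 
      ∫⁻ z, ‖invFourierS (m k i) (x - z)‖ₑ * F i z ≤
        C * (e2 (-((k - i : ℕ) * T)) * ∫⁻ z, e2 (i * n) * V i 0 (x - z) ^ (N : ℝ) * F i z) := by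
  obtain ⟨C1, N', hC1, hk⟩ := kernel_bound (n := n) N
  obtain ⟨C2, h2⟩ := h.low N'
  refine ⟨ENNReal.ofReal (C1 * C2), ENNReal.ofReal_ne_top, fun F k i x hik => ?_⟩
  obtain ⟨d, rfl⟩ : ∃ d, k = i + d := ⟨k - i, by omega⟩
  rw [Nat.add_sub_cancel_left, ← mul_assoc, ← lintegral_const_mul' _ _ (ENNReal.mul_ne_top ENNReal.ofReal_ne_top (e2_ne_top _))]
  refine lintegral_mono fun z => ?_
  rw [← mul_assoc]
  refine mul_le_mul_left ?_ _
  refine (hk _ i _).trans ?_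
  have hC2 : 0 ≤ C2 := by
    have := (Q_nonneg _ _).trans (h2 0 1 one_pos)
    exact nonneg_of_mul_nonneg_left this (by positivity)
  calc _ ≤ ENNReal.ofReal (C1 * (C2 * 2 ^ (-((d : ℝ) * T)))) * (e2 (i * n) * V i 0 (x - z) ^ N) := by
        gcongr
        exact h2 i d (by omega)
    _ = _ := by
        rw [ENNReal.rpow_natCast, ← mul_assoc C1, ENNReal.ofReal_mul (by positivity), e2_ofReal (-(d * T))]

lemma tsum_split (f : ℕ → ℝ≥0∞) (k : ℕ) : ∑' i, f i = ∑ i ∈ Finset.range k, f i + ∑' d, f (k + d) := by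
  rw [← ENNReal.summable.sum_add_tsum_nat_add' (k := k)]
  simp only [add_comm]

lemma expd_Gb {n : ℕ} {E : Type*} [NormedAddCommGroup E] [NormedSpace ℂ E] {T : ℝ} {a b : ℕ → Sch n}
    {m : ℕ → ℕ → Sch n} (h : Expd T a b m) (N : ℕ) :
    ∃ C : ℝ≥0∞, C ≠ ∞ ∧ ∀ f : TDist n E, Gb N T C (fun i z => ‖mOp (a i) f z‖ₑ) (fun i z => ‖mOp (b i) f z‖ₑ) := by
  obtain ⟨C1, hC1, h1⟩ := expd_high h N
  obtain ⟨C2, hC2, h2⟩ := expd_low h N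
  refine ⟨C1 + C2, ENNReal.add_ne_top.2 ⟨hC1, hC2⟩, fun f k x => ?_⟩
  refine (expd_point h f k x).trans ?_
  rw [tsum_split _ k, add_comm (Finset.sum _ _), mul_add]
  refine add_le_add ?_ ?_
  · rw [RR, ← ENNReal.tsum_mul_left]
    refine ENNReal.tsum_le_tsum fun d => (h1 (fun i z => ‖mOp (a i) f z‖ₑ) k d x).trans ?_
    gcongr
    exact le_self_add
  · rw [Finset.mul_sum]
    refine Finset.sum_le_sum fun i hi => (h2 (fun i z => ‖mOp (a i) f z‖ₑ) k i x (Finset.mem_range.1 hi)).trans ?_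
    gcongr
    exact le_add_self

lemma expd_K1 {n : ℕ} {E : Type*} [NormedAddCommGroup E] [NormedSpace ℂ E] {T : ℝ} {a : ℕ → Sch n}
    {m : ℕ → ℕ → Sch n} (h : Expd T a a m) (h0 : ∀ k i, i < k → m k i = 0) (N : ℕ) :
    ∃ C : ℝ≥0∞, C ≠ ∞ ∧ ∀ f : TDist n E, K1 N C (fun i z => ‖mOp (a i) f z‖ₑ) := by
  obtain ⟨C1, hC1, h1⟩ := expd_high h N
  refine ⟨C1, hC1, fun f k x => ?_⟩
  refine (expd_point h f k x).trans ?_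
  rw [tsum_split _ k, Finset.sum_eq_zero, zero_add]
  · rw [RR, ← ENNReal.tsum_mul_left]
    exact ENNReal.tsum_le_tsum fun d => h1 (fun i z => ‖mOp (a i) f z‖ₑ) k d x
  · intro i hi
    rw [h0 k i (Finset.mem_range.1 hi)]
    have : invFourierS (0 : Sch n) = 0 := map_zero _
    simp [this]

lemma temp_of {n : ℕ} {E : Type*} [NormedAddCommGroup E] [NormedSpace ℂ E] {a : ℕ → Sch n}
    (h : ∀ N, ∃ (C : ℝ) (P : ℕ), ∀ l, Q N (a l) ≤ C * (2 ^ l) ^ P) (f : TDist n E) :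
    Temp (fun i z => ‖mOp (a i) f z‖ₑ) := by
  obtain ⟨C, N, N', hC, hb⟩ := mOp_bound f
  obtain ⟨C1, P, h1⟩ := h N'
  have hC1 : 0 ≤ C1 := by
    have := (Q_nonneg _ _).trans (h1 0)
    simpa using this
  refine ⟨ENNReal.ofReal (C * C1), N + P, ENNReal.ofReal_ne_top, fun l y => ?_⟩
  have e : (2 : ℝ≥0∞) ^ l * ENNReal.ofReal (1 + ‖y‖) = ENNReal.ofReal (2 ^ l * (1 + ‖y‖)) := by
    rw [ENNReal.ofReal_mul (by positivity), ENNReal.ofReal_pow (by norm_num)]; simp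
  change ‖mOp (a l) f y‖ₑ ≤ _
  rw [e, ← ENNReal.ofReal_pow (by positivity), ← ENNReal.ofReal_mul (by positivity), ← ofReal_norm]
  refine ENNReal.ofReal_le_ofReal ?_
  have hl : (1 : ℝ) ≤ 2 ^ l := one_le_pow₀ (by norm_num)
  have hy : (1 : ℝ) ≤ 1 + ‖y‖ := by linarith [norm_nonneg y]
  calc _ ≤ C * (1 + ‖y‖) ^ N * Q N' (a l) := hb _ _
    _ ≤ C * (1 + ‖y‖) ^ N * (C1 * (2 ^ l) ^ P) := by gcongr; exact h1 l
    _ = C * C1 * ((2 ^ l) ^ P * (1 + ‖y‖) ^ N) := by ring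
    _ ≤ C * C1 * ((2 ^ l) ^ (N + P) * (1 + ‖y‖) ^ (N + P)) := by
        gcongr
        · omega
        · omega
    _ = _ := by rw [mul_pow]

/-- main comparison -/
lemma compare {n : ℕ} {E : Type*} [NormedAddCommGroup E] [NormedSpace ℂ E] {s T T' : ℝ} (hT : s < T) {p q : ℝ≥0∞}
    (hp : 0 < p) (hq : 0 < q) {a b : ℕ → Sch n} {m m' : ℕ → ℕ → Sch n}
    (htemp : ∀ N, ∃ (C : ℝ) (P : ℕ), ∀ l, Q N (a l) ≤ C * (2 ^ l) ^ P)
    (h1 : Expd T' a a m) (h0 : ∀ k i, i < k → m k i = 0) (h2 : Expd T a b m') :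
    ∃ C : ℝ≥0∞, C ≠ ∞ ∧ ∀ f : TDist n E,
      lqSum q (fun k => e2 (k * s) * eLpNorm (mOp (b k) f) p volume) ≤
        C * lqSum q (fun k => e2 (k * s) * eLpNorm (mOp (a k) f) p volume) := by
  obtain ⟨N', hm⟩ := abstract_main n s T hT p q hp hq
  choose CC hCC hK using expd_K1 (E := E) h1 h0
  obtain ⟨C2, hC2, hG⟩ := expd_Gb (E := E) h2 N'
  obtain ⟨C', hC', H⟩ := hm CC hCC C2 hC2
  refine ⟨C', hC', fun f => ?_⟩
  have := H _ _ (fun j => (mOp_continuous (a j) f).enorm.measurable) (temp_of htemp f) (fun N => hK N f) (hG f)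
  simpa only [eLpNorm_enorm] using this

end Aux

namespace Aux
open LineDeriv

lemma pdS_comm {n : ℕ} (i j : Fin n) (g : Sch n) : pdS i (pdS j g) = pdS j (pdS i g) := by
  have hd : ∀ x, HasFDerivAt (fderiv ℝ g) (fderiv ℝ (fderiv ℝ g) x) x := fun x =>
    (((g.smooth 2).fderiv_right (m := 1) (by norm_num)).differentiable (by norm_num) x).hasFDerivAt
  have key : ∀ (i j : Fin n) (x : Rn n), pdS i (pdS j g) x = fderiv ℝ (fderiv ℝ g) x (ev i) (ev j) := by
    intro i j x
    have e : (pdS j g : Rn n → ℂ) = fun x => fderiv ℝ g x (ev j) := by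
      ext x; exact SchwartzMap.lineDerivOp_apply_eq_fderiv (ev j) g x
    have h1 : pdS i (pdS j g) x = fderiv ℝ (pdS j g) x (ev i) :=
      SchwartzMap.lineDerivOp_apply_eq_fderiv (ev i) (pdS j g) x
    rw [h1, e]
    have := ((hd x).clm_apply (hasFDerivAt_const (ev j) x)).fderiv
    rw [this]
    simp
  ext x
  rw [key, key]
  exact second_derivative_symmetric (f := g) (fun y => g.differentiableAt.hasFDerivAt) (hd x) _ _

lemma dl_perm {n : ℕ} {L L' : List (Fin n)} (h : L.Perm L') (g : Sch n) : dl L g = dl L' g :=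
  h.foldr_eq' (fun i _ j _ g => pdS_comm j i g) g

lemma dl_ofFn {n l : ℕ} (I : Fin l → Fin n) (g : Sch n) (x : Rn n) :
    dl (List.ofFn I) g x = iteratedFDeriv ℝ l g x (fun j => ev (I j)) := by
  rw [← iteratedLineDerivOp_eq_iteratedFDeriv]
  congr 1
  induction l with
  | zero => simp [dl]
  | succ l ih =>
    rw [List.ofFn_succ, iteratedLineDerivOp_succ_left]
    exact congrArg (pdS (I 0)) (ih _)

/-- multi-index of a tuple -/
def cnt {n l : ℕ} (I : Fin l → Fin n) : Fin n → ℕ := fun i => (List.ofFn I).count i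

lemma cnt_perm {n l : ℕ} (I : Fin l → Fin n) : (List.ofFn I).Perm (mlist (cnt I)) := by
  rw [List.perm_iff_count]
  intro i
  unfold mlist
  rw [List.count_flatMap]
  have : (List.count i ∘ fun i => List.replicate (cnt I i) i) = fun j => if j = i then cnt I i else 0 := by
    ext j
    simp only [Function.comp, List.count_replicate]
    by_cases h : j = i
    · simp [h]
    · simp [h]
  rw [this, ← List.ofFn_eq_map, List.sum_ofFn]
  simp [cnt]

lemma mdeg_cnt {n l : ℕ} (I : Fin l → Fin n) : mdeg (cnt I) = l := by
  rw [← mlist_length, ← (cnt_perm I).length_eq, List.length_ofFn]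

lemma mderiv_cnt {n l : ℕ} (I : Fin l → Fin n) (g : Sch n) (x : Rn n) :
    mderiv (cnt I) (fun y => g y) x = iteratedFDeriv ℝ l g x (fun j => ev (I j)) := by
  rw [mderiv_eq, ← dl_perm (cnt_perm I)]; exact dl_ofFn I g x

lemma bridge {n : ℕ} (l : ℕ) (g : Sch n) (x : Rn n) :
    ‖iteratedFDeriv ℝ l g x‖ ≤ ∑ I : Fin l → Fin n, ‖mderiv (cnt I) (fun y => g y) x‖ := by
  refine ContinuousMultilinearMap.opNorm_le_bound (Finset.sum_nonneg fun _ _ => norm_nonneg _) fun m => ?_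
  have e : m = fun j => ∑ i, (m j i) • ev i := by
    ext j i
    simp [ev, Finset.sum_apply, Pi.single_apply]
  conv_lhs => rw [e, ContinuousMultilinearMap.map_sum]
  rw [Finset.sum_mul]
  refine norm_sum_le_of_le _ fun I _ => ?_
  rw [ContinuousMultilinearMap.map_smul_univ, norm_smul, mderiv_cnt, mul_comm, norm_prod]
  gcongr with j
  exact PiLp.norm_apply_le (m j) (I j)

end Aux

namespace Aux

lemma dil_D {n : ℕ} (m : Sch n) {t : ℝ} (ht : t ≠ 0) (l : ℕ) (x : Rn n) :
    ‖iteratedFDeriv ℝ l (dilate m t) x‖ = |t| ^ l * ‖iteratedFDeriv ℝ l m (t • x)‖ := by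
  have e : (dilate m t : Rn n → ℂ) = fun x => m (t • x) := by
    ext x; exact dilate_apply m ht x
  rw [e, iteratedFDeriv_comp_const_smul t (m.smooth l), norm_smul, norm_pow, Real.norm_eq_abs]

lemma dil_D_le {n : ℕ} (m : Sch n) {t : ℝ} (ht : 0 < t) (ht1 : t ≤ 1) {l N : ℕ} (hl : l ≤ N) (x : Rn n) :
    ‖iteratedFDeriv ℝ l (dilate m t) x‖ ≤ Q N m := by
  rw [dil_D m ht.ne', abs_of_pos ht]
  have h1 := le_Q (Nat.zero_le N) hl m (t • x)
  rw [pow_zero, one_mul] at h1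
  calc _ ≤ 1 * Q N m := mul_le_mul (pow_le_one₀ ht.le ht1) h1 (norm_nonneg _) zero_le_one
    _ = _ := one_mul _

lemma dil_dil {n : ℕ} (m : Sch n) {t u : ℝ} (ht : t ≠ 0) (hu : u ≠ 0) :
    dilate (dilate m t) u = dilate m (t * u) := by
  ext x
  rw [dilate_apply _ hu, dilate_apply _ ht, dilate_apply _ (mul_ne_zero ht hu), smul_smul]

lemma dil_one {n : ℕ} (m : Sch n) : dilate m 1 = m := by
  ext x
  rw [dilate_apply _ one_ne_zero, one_smul]

lemma dil_mulS {n : ℕ} (m a : Sch n) {t : ℝ} (ht : t ≠ 0) :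
    dilate (mulS m a) t = mulS (dilate m t) (dilate a t) := by
  ext x
  simp only [dilate_apply _ ht, mulS_apply]

lemma Q_dil {n : ℕ} (N : ℕ) (m : Sch n) {t : ℝ} (ht : 1 ≤ t) :
    Q N (dilate m t⁻¹) ≤ t ^ N * Q N m := by
  have h0 : 0 < t := by linarith
  refine Q_le (mul_nonneg (by positivity) (Q_nonneg _ _)) fun k hk l hl x => ?_
  rw [dil_D m (by positivity), abs_of_pos (by positivity)]
  have h1 := le_Q hk hl m (t⁻¹ • x)
  rw [norm_smul, norm_inv, Real.norm_eq_abs, abs_of_pos h0] at h1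
  have h2 : ‖x‖ ^ k = t ^ k * (t⁻¹ * ‖x‖) ^ k := by
    rw [← mul_pow, ← mul_assoc, mul_inv_cancel₀ h0.ne', one_mul]
  calc _ = (t ^ k * t⁻¹ ^ l) * ((t⁻¹ * ‖x‖) ^ k * ‖iteratedFDeriv ℝ l m (t⁻¹ • x)‖) := by rw [h2]; ring
    _ ≤ (t ^ N * 1) * Q N m := by
        refine mul_le_mul (mul_le_mul (pow_le_pow_right₀ ht hk) ?_ (by positivity) (by positivity)) h1
          (by positivity) (by positivity)
        exact pow_le_one₀ (by positivity) (inv_le_one_of_one_le₀ ht)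
    _ = _ := by ring

lemma lemD {n : ℕ} {N P : ℕ} {B R : ℝ} {r g : Sch n} {σ : Rn n → ℂ} (hr : ∀ x, r x = g x * σ x)
    (hσ : ContDiff ℝ ((⊤ : ℕ∞) : WithTop ℕ∞) σ) (hB0 : 0 ≤ B) (hB : ∀ l ≤ N, ∀ x, ‖iteratedFDeriv ℝ l σ x‖ ≤ B) (hR0 : 0 ≤ R)
    (hR : ∀ x, ‖x‖ < R → σ x = 0) : R ^ P * Q N r ≤ 2 ^ N * B * Q (N + P) g := by
  have hn : 0 ≤ 2 ^ N * B * Q (N + P) g := mul_nonneg (by positivity) (Q_nonneg _ _)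
  rcases (pow_nonneg hR0 P).eq_or_lt with h0 | h0
  · rw [← h0, zero_mul]; exact hn
  rw [mul_comm, ← le_div_iff₀ h0]
  refine Q_le (by positivity) fun k hk l hl x => ?_
  rw [le_div_iff₀ h0]
  have er : (r : Rn n → ℂ) = fun x => g x * σ x := funext hr
  by_cases hx : ‖x‖ < R
  · have : (r : Rn n → ℂ) =ᶠ[𝓝 x] fun _ => 0 := by
      have : {y : Rn n | ‖y‖ < R} ∈ 𝓝 x := (isOpen_lt continuous_norm continuous_const).mem_nhds hx
      filter_upwards [this] with y hy
      rw [hr, hR y hy, mul_zero]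
    rw [(this.iteratedFDeriv ℝ l).self_of_nhds]
    have : iteratedFDeriv ℝ l (fun _ : Rn n => (0 : ℂ)) x = 0 := by
      rw [iteratedFDeriv_fun_zero]; rfl
    rw [this]; simpa using hn
  · push Not at hx
    have hRP : R ^ P ≤ ‖x‖ ^ P := pow_le_pow_left₀ hR0 hx P
    have h1 := norm_iteratedFDeriv_mul_le (𝕜 := ℝ) (N := ((⊤ : ℕ∞) : WithTop ℕ∞)) (f := g) g.smooth' hσ x (n := l) (by exact_mod_cast le_top)
    rw [← er] at h1
    have h2 : ‖x‖ ^ (k + P) * ‖iteratedFDeriv ℝ l r x‖ ≤ 2 ^ l * (B * Q (N + P) g) := by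
      calc _ ≤ ‖x‖ ^ (k + P) * _ := mul_le_mul_of_nonneg_left h1 (by positivity)
        _ = ∑ i ∈ Finset.range (l + 1), (l.choose i : ℝ) * ((‖x‖ ^ (k + P) * ‖iteratedFDeriv ℝ i g x‖)
            * ‖iteratedFDeriv ℝ (l - i) σ x‖) := by
            rw [Finset.mul_sum]; refine Finset.sum_congr rfl fun i _ => ?_; ring
        _ ≤ ∑ i ∈ Finset.range (l + 1), (l.choose i : ℝ) * (Q (N + P) g * B) := by
            refine Finset.sum_le_sum fun i hi => ?_
            have hi := Finset.mem_range.1 hi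
            refine mul_le_mul_of_nonneg_left (mul_le_mul (le_Q (by omega) (by omega) g x) (hB _ (by omega) x)
              (norm_nonneg _) (Q_nonneg _ _)) (by positivity)
        _ = _ := by
            rw [← Finset.sum_mul]
            have := Nat.sum_range_choose l
            have : (∑ i ∈ Finset.range (l + 1), (l.choose i : ℝ)) = 2 ^ l := by exact_mod_cast this
            rw [this]; ring
    calc _ ≤ ‖x‖ ^ k * ‖iteratedFDeriv ℝ l r x‖ * ‖x‖ ^ P := mul_le_mul_of_nonneg_left hRP (by positivity)
      _ = ‖x‖ ^ (k + P) * ‖iteratedFDeriv ℝ l r x‖ := by ring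
      _ ≤ _ := h2
      _ ≤ 2 ^ N * (B * Q (N + P) g) := mul_le_mul_of_nonneg_right (pow_le_pow_right₀ (by norm_num) hl)
          (mul_nonneg hB0 (Q_nonneg _ _))
      _ = _ := by ring

/-- multiplication by a Schwartz function, simple bound -/
lemma Q_mulS {n : ℕ} (N : ℕ) (g σ : Sch n) : Q N (mulS g σ) ≤ 2 ^ N * Q N σ * Q N g := by
  have := lemD (N := N) (P := 0) (B := Q N σ) (R := 0) (r := mulS g σ) (g := g) (σ := σ) (fun x => mulS_apply _ _ _)
    σ.smooth' (Q_nonneg _ _) (fun l hl x => by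
      have := le_Q (Nat.zero_le N) hl σ x
      rwa [pow_zero, one_mul] at this) le_rfl (fun x hx => absurd hx (norm_nonneg x).not_gt)
  simpa using this

lemma lemF {n : ℕ} {N : ℕ} {B R : ℝ} {r g σ : Sch n} (hr : ∀ x, r x = g x * σ x)
    (hB0 : 0 ≤ B) (hR : ∀ x, R < ‖x‖ → g x = 0)
    (hB : ∀ l ≤ N, ∀ x, ‖x‖ ≤ R → ‖iteratedFDeriv ℝ l σ x‖ ≤ B)
     : Q N r ≤ 2 ^ N * B * Q N g := by
  have hn : 0 ≤ 2 ^ N * B * Q N g := mul_nonneg (by positivity) (Q_nonneg _ _)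
  refine Q_le hn fun k hk l hl x => ?_
  have er : (r : Rn n → ℂ) = fun x => g x * σ x := funext hr
  by_cases hx : R < ‖x‖
  · have : (r : Rn n → ℂ) =ᶠ[𝓝 x] fun _ => 0 := by
      have : {y : Rn n | R < ‖y‖} ∈ 𝓝 x := (isOpen_lt continuous_const continuous_norm).mem_nhds hx
      filter_upwards [this] with y hy
      rw [hr, hR y hy, zero_mul]
    rw [(this.iteratedFDeriv ℝ l).self_of_nhds]
    have : iteratedFDeriv ℝ l (fun _ : Rn n => (0 : ℂ)) x = 0 := by
      rw [iteratedFDeriv_fun_zero]; rfl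
    rw [this]; simpa using hn
  · push Not at hx
    have h1 := norm_iteratedFDeriv_mul_le (𝕜 := ℝ) (N := ((⊤ : ℕ∞) : WithTop ℕ∞)) (f := g) (g := σ) g.smooth' σ.smooth' x (n := l) (by exact_mod_cast le_top)
    rw [← er] at h1
    calc _ ≤ ‖x‖ ^ k * _ := mul_le_mul_of_nonneg_left h1 (by positivity)
        _ = ∑ i ∈ Finset.range (l + 1), (l.choose i : ℝ) * ((‖x‖ ^ k * ‖iteratedFDeriv ℝ i g x‖)
            * ‖iteratedFDeriv ℝ (l - i) σ x‖) := by
            rw [Finset.mul_sum]; refine Finset.sum_congr rfl fun i _ => ?_; ring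
        _ ≤ ∑ i ∈ Finset.range (l + 1), (l.choose i : ℝ) * (Q N g * B) := by
            refine Finset.sum_le_sum fun i hi => ?_
            have hi := Finset.mem_range.1 hi
            refine mul_le_mul_of_nonneg_left (mul_le_mul (le_Q (by omega) (by omega) g x) (hB _ (by omega) x hx)
              (norm_nonneg _) (Q_nonneg _ _)) (by positivity)
        _ = 2 ^ l * (B * Q N g) := by
            rw [← Finset.sum_mul]
            have := Nat.sum_range_choose l
            have : (∑ i ∈ Finset.range (l + 1), (l.choose i : ℝ)) = 2 ^ l := by exact_mod_cast this
            rw [this]; ring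
        _ ≤ 2 ^ N * (B * Q N g) := mul_le_mul_of_nonneg_right (pow_le_pow_right₀ (by norm_num) hl)
          (mul_nonneg hB0 (Q_nonneg _ _))
        _ = _ := by ring

end Aux

namespace Aux

lemma res_bound {n : ℕ} {φ : ℕ → Sch n} (hφ : SmoothResolution n φ) (l : ℕ) :
    ∃ C : ℝ, 0 ≤ C ∧ ∀ j ξ, ‖iteratedFDeriv ℝ l (φ j) ξ‖ ≤ C * ((2 ^ j) ^ l)⁻¹ := by
  choose c hc using hφ.deriv_bound
  refine ⟨∑ I : Fin l → Fin n, |c (cnt I)|, Finset.sum_nonneg fun _ _ => abs_nonneg _, fun j ξ => ?_⟩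
  refine (bridge l (φ j) ξ).trans ?_
  rw [Finset.sum_mul]
  refine Finset.sum_le_sum fun I _ => (hc _ j ξ).trans ?_
  rw [mdeg_cnt, neg_mul, Real.rpow_neg (by norm_num), Real.rpow_mul (by norm_num), Real.rpow_natCast,
    Real.rpow_natCast]
  exact mul_le_mul_of_nonneg_right (le_abs_self _) (by positivity)

lemma mom_zero {n : ℕ} {ψ : Sch n} {S : ℤ}
    (hmom : ∀ α : Fin n → ℕ, (mdeg α : ℤ) ≤ S → mderiv α (fun y => ψ y) 0 = 0) (l : ℕ) (hl : l < (S + 1).toNat) :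
    iteratedFDeriv ℝ l ψ 0 = 0 := by
  rw [← norm_le_zero_iff]
  refine (bridge l ψ 0).trans ?_
  rw [Finset.sum_eq_zero]
  intro I _
  rw [hmom _ (by rw [mdeg_cnt]; omega), norm_zero]

lemma flat {n : ℕ} (g : Sch n) (T : ℕ) (h : ∀ l < T, iteratedFDeriv ℝ l g 0 = 0) :
    ∀ d ≤ T, ∃ C : ℝ, 0 ≤ C ∧ ∀ x, ‖iteratedFDeriv ℝ (T - d) g x‖ ≤ C * ‖x‖ ^ d := by
  intro d
  induction d with
  | zero =>
    intro _
    refine ⟨Q T g, Q_nonneg _ _, fun x => ?_⟩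
    simpa using le_Q (Nat.zero_le T) (le_refl T) g x
  | succ d ih =>
    intro hd
    obtain ⟨C, hC, hh⟩ := ih (by omega)
    refine ⟨C, hC, fun x => ?_⟩
    have e : T - d = T - (d + 1) + 1 := by omega
    have h1 := (convex_closedBall (0 : Rn n) ‖x‖).norm_image_sub_le_of_norm_fderiv_le (𝕜 := ℝ)
      (f := iteratedFDeriv ℝ (T - (d + 1)) g) (C := C * ‖x‖ ^ d)
      (fun y _ => (g.smooth'.differentiable_iteratedFDeriv (m := T - (d + 1)) (WithTop.coe_lt_coe.2 (ENat.natCast_lt_top _))) y)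
      (fun y hy => by
        rw [norm_fderiv_iteratedFDeriv, ← e]
        refine (hh y).trans ?_
        have : ‖y‖ ≤ ‖x‖ := by simpa using hy
        gcongr)
      (x := 0) (y := x) (by simp) (by simp)
    rw [h _ (by omega), sub_zero, sub_zero] at h1
    rw [pow_succ, ← mul_assoc]
    exact h1

lemma exists_bump (n : ℕ) {r R : ℝ} (hr : 0 < r) (hR : r < R) : ∃ χ : Sch n,
    (∀ x, ‖x‖ ≤ r → χ x = 1) ∧ (∀ x, R ≤ ‖x‖ → χ x = 0) := by
  let f : ContDiffBump (0 : Rn n) := ⟨r, R, hr, hR⟩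
  have hc : HasCompactSupport (fun x => (f x : ℂ)) := by
    have := f.hasCompactSupport
    exact this.comp_left (g := fun t : ℝ => (t : ℂ)) (by simp)
  have hs : ContDiff ℝ ((⊤ : ℕ∞) : WithTop ℕ∞) (fun x => (f x : ℂ)) :=
    Complex.ofRealCLM.contDiff.comp f.contDiff
  refine ⟨hc.toSchwartzMap hs, fun x hx => ?_, fun x hx => ?_⟩
  · have := f.one_of_mem_closedBall (x := x) (by simpa [f] using hx)
    change ((f x : ℝ) : ℂ) = 1
    rw [this]; simp
  · have := f.zero_of_le_dist (x := x) (by simpa [f] using hx)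
    change ((f x : ℝ) : ℂ) = 0
    rw [this]; simp

lemma exists_div {n : ℕ} (g h : Sch n) {K : Set (Rn n)} (hK : IsCompact K) (hg : ∀ x, x ∉ K → g x = 0)
    (hh : ∀ x ∈ K, h x ≠ 0) : ∃ r : Sch n, (∀ x, r x * h x = g x) ∧ (∀ x, g x = 0 → r x = 0) := by
  have hc : HasCompactSupport (fun x => g x / h x) :=
    HasCompactSupport.intro hK fun x hx => by rw [hg x hx, zero_div]
  have hs : ContDiff ℝ ((⊤ : ℕ∞) : WithTop ℕ∞) (fun x => g x / h x) := by
    rw [contDiff_iff_contDiffAt]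
    intro x
    by_cases hx : x ∈ K
    · simp only [div_eq_mul_inv]
      exact ContDiffAt.mul (f := g) (g := fun x => (h x)⁻¹) g.smooth'.contDiffAt
        (ContDiffAt.inv (f := h) h.smooth'.contDiffAt (hh x hx))
    · have : (fun x => g x / h x) =ᶠ[𝓝 x] fun _ => 0 := by
        filter_upwards [hK.isClosed.isOpen_compl.mem_nhds hx] with y hy
        rw [hg y hy, zero_div]
      exact contDiffAt_const.congr_of_eventuallyEq this
  refine ⟨hc.toSchwartzMap hs, fun x => ?_, fun x hx => ?_⟩
  · change g x / h x * h x = g x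
    by_cases hx : x ∈ K
    · rw [div_mul_cancel₀ _ (hh x hx)]
    · rw [hg x hx]; simp
  · change g x / h x = 0
    rw [hx, zero_div]

end Aux

namespace Aux

/-- the system generated by two functions -/
def sys {n : ℕ} (A B : Sch n) (i : ℕ) : Sch n := if i = 0 then A else dilate B ((2 : ℝ) ^ i)⁻¹

lemma sys_dil_self {n : ℕ} (A B : Sch n) (k : ℕ) :
    dilate (sys A B k) (2 ^ k) = if k = 0 then A else B := by
  unfold sys
  split_ifs with h
  · rw [h, pow_zero, dil_one]
  · rw [dil_dil _ (by positivity) (by positivity), inv_mul_cancel₀ (by positivity), dil_one]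

lemma sys_dil {n : ℕ} (A B : Sch n) (k d : ℕ) (hd : 0 < d) :
    dilate (sys A B (k + d)) (2 ^ k) = dilate B ((2 : ℝ) ^ d)⁻¹ := by
  unfold sys
  rw [if_neg (by omega), dil_dil _ (by positivity) (by positivity)]
  congr 1
  rw [pow_add]; field_simp

lemma sys_temp {n : ℕ} (A B : Sch n) (N i : ℕ) : Q N (sys A B i) ≤ (Q N A + Q N B) * (2 ^ i) ^ N := by
  have hA := Q_nonneg N A
  have hB := Q_nonneg N B
  unfold sys
  split_ifs with h
  · rw [h]; simp [hB]
  · refine (Q_dil N B (one_le_pow₀ (by norm_num))).trans ?_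
    rw [mul_comm]
    exact mul_le_mul_of_nonneg_right (by linarith) (by positivity)

lemma sys_self_Q {n : ℕ} (A B : Sch n) (N k : ℕ) : Q N (dilate (sys A B k) (2 ^ k)) ≤ Q N A + Q N B := by
  have hA := Q_nonneg N A
  have hB := Q_nonneg N B
  rw [sys_dil_self]; split_ifs <;> linarith

lemma dil_vanish {n : ℕ} {B : Sch n} {ρ : ℝ} (hB : ∀ x, ‖x‖ < ρ → B x = 0) (d : ℕ) (x : Rn n)
    (hx : ‖x‖ < ρ * 2 ^ d) : dilate B ((2 : ℝ) ^ d)⁻¹ x = 0 := by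
  rw [dilate_apply _ (by positivity)]
  refine hB _ ?_
  rw [norm_smul, norm_inv, norm_pow, Real.norm_ofNat]
  rwa [inv_mul_lt_iff₀ (by positivity), mul_comm]

lemma high_gen {n : ℕ} {b : ℕ → Sch n} {A B : Sch n} {ρ : ℝ} (hρ : 0 < ρ) (hB : ∀ x, ‖x‖ < ρ → B x = 0)
    {G : ℕ → ℝ} (hG : ∀ N k, Q N (dilate (b k) (2 ^ k)) ≤ G N) (N P : ℕ) :
    ∃ C : ℝ, 0 ≤ C ∧ ∀ k d, Q N (dilate (mulS (b k) (sys A B (k + d))) (2 ^ k)) ≤ C * ((2 ^ d) ^ P)⁻¹ := by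
  have G0 : ∀ N, 0 ≤ G N := fun N => (Q_nonneg _ _).trans (hG N 0)
  have hA0 := Q_nonneg N A
  have hB0 := Q_nonneg N B
  have g1 := G0 N
  have g2 := G0 (N + P)
  refine ⟨2 ^ N * (Q N A + Q N B) * G N + 2 ^ N * Q N B * G (N + P) * (ρ ^ P)⁻¹, by positivity, fun k d => ?_⟩
  have ht : (2 : ℝ) ^ k ≠ 0 := by positivity
  rw [dil_mulS _ _ ht]
  rcases Nat.eq_zero_or_pos d with rfl | hd
  · simp only [add_zero, pow_zero, one_pow, inv_one, mul_one]
    have h1 := Q_mulS N (dilate (b k) (2 ^ k)) (dilate (sys A B k) (2 ^ k))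
    have h2 : 2 ^ N * Q N (dilate (sys A B k) (2 ^ k)) * Q N (dilate (b k) (2 ^ k))
      ≤ 2 ^ N * (Q N A + Q N B) * G N := mul_le_mul (mul_le_mul_of_nonneg_left (sys_self_Q _ _ _ _) (by positivity))
        (hG _ _) (Q_nonneg _ _) (by positivity)
    have h3 : 0 ≤ 2 ^ N * Q N B * G (N + P) * (ρ ^ P)⁻¹ := by positivity
    linarith
  · rw [sys_dil _ _ _ _ hd]
    have h1 := lemD (N := N) (P := P) (B := Q N B) (R := ρ * 2 ^ d) (mulS_apply (dilate (b k) (2 ^ k))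
      (dilate B ((2 : ℝ) ^ d)⁻¹)) (dilate B ((2 : ℝ) ^ d)⁻¹).smooth' hB0
      (fun l hl x => dil_D_le B (by positivity) (inv_le_one_of_one_le₀ (one_le_pow₀ (by norm_num))) hl x)
      (by positivity) (dil_vanish hB d)
    have h2 : 2 ^ N * Q N B * Q (N + P) (dilate (b k) (2 ^ k)) ≤ 2 ^ N * Q N B * G (N + P) :=
      mul_le_mul_of_nonneg_left (hG _ _) (by positivity)
    have h3 : 0 ≤ 2 ^ N * (Q N A + Q N B) * G N := by positivity
    rw [← div_eq_mul_inv, le_div_iff₀ (by positivity)]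
    have h4 := h1.trans h2
    rw [mul_pow, mul_assoc, mul_comm, ← le_div_iff₀ (by positivity), div_eq_mul_inv] at h4
    linarith

lemma const_D {n : ℕ} (l : ℕ) (x : Rn n) : ‖iteratedFDeriv ℝ l (fun _ : Rn n => (1 : ℂ)) x‖ ≤ 1 := by
  rcases Nat.eq_zero_or_pos l with rfl | h
  · simp
  · rw [iteratedFDeriv_const_of_ne (by omega)]; simp

lemma tend_of {u : ℕ → ℝ} {K : ℝ} {J0 : ℕ} (hu : ∀ J, 0 ≤ u J) (h : ∀ J, J0 ≤ J → 2 ^ J * u (J + 1) ≤ K) :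
    Tendsto u atTop (𝓝 0) := by
  rw [← tendsto_add_atTop_iff_nat 1]
  have h1 : Tendsto (fun J : ℕ => K * ((2 : ℝ)⁻¹) ^ J) atTop (𝓝 0) := by
    have := (tendsto_pow_atTop_nhds_zero_of_lt_one (r := (2 : ℝ)⁻¹) (by norm_num) (by norm_num)).const_mul K
    rwa [mul_zero] at this
  refine tendsto_of_tendsto_of_tendsto_of_le_of_le' tendsto_const_nhds h1 (Eventually.of_forall fun J => hu _) ?_
  filter_upwards [eventually_ge_atTop J0] with J hJ
  rw [inv_pow, ← div_eq_mul_inv, le_div_iff₀ (by positivity), mul_comm]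
  exact h J hJ

lemma conv_gen {n : ℕ} {g χ : Sch n} {ρ : ℝ} (hρ : 0 < ρ) (hχ : ∀ x, ‖x‖ < ρ → χ x = 1) (r : ℕ → Sch n) (J0 : ℕ)
    (hr : ∀ J, J0 ≤ J → ∀ x, r (J + 1) x = g x * (1 - dilate χ ((2 : ℝ) ^ J)⁻¹ x)) (N : ℕ) :
    Tendsto (fun J => Q N (r J)) atTop (𝓝 0) := by
  have hB0 := Q_nonneg N χ
  refine tend_of (K := 2 ^ N * (1 + Q N χ) * Q (N + 1) g / ρ) (J0 := J0) (fun _ => Q_nonneg _ _) fun J hJ => ?_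
  have hs : ContDiff ℝ ((⊤ : ℕ∞) : WithTop ℕ∞) (fun x : Rn n => 1 - dilate χ ((2 : ℝ) ^ J)⁻¹ x) :=
    contDiff_const.sub (dilate χ ((2 : ℝ) ^ J)⁻¹).smooth'
  have h1 := lemD (N := N) (P := 1) (B := 1 + Q N χ) (R := ρ * 2 ^ J) (hr J hJ) hs (by positivity)
    (fun l hl x => by
      have e : iteratedFDeriv ℝ l (fun x : Rn n => 1 - dilate χ ((2 : ℝ) ^ J)⁻¹ x) x
        = iteratedFDeriv ℝ l (fun _ : Rn n => (1 : ℂ)) x - iteratedFDeriv ℝ l (dilate χ ((2 : ℝ) ^ J)⁻¹) x :=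
        iteratedFDeriv_sub_apply (f := fun _ : Rn n => (1 : ℂ)) (g := dilate χ ((2 : ℝ) ^ J)⁻¹)
          contDiff_const.contDiffAt ((dilate χ ((2 : ℝ) ^ J)⁻¹).smooth l).contDiffAt
      rw [e]
      exact (norm_sub_le _ _).trans (add_le_add (const_D l x)
        (dil_D_le χ (by positivity) (inv_le_one_of_one_le₀ (one_le_pow₀ (by norm_num))) hl x)))
      (by positivity) (fun x hx => by
        rw [sub_eq_zero, dilate_apply _ (by positivity)]
        refine (hχ _ ?_).symm
        rw [norm_smul, norm_inv, norm_pow, Real.norm_ofNat]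
        rwa [inv_mul_lt_iff₀ (by positivity), mul_comm])
  rw [le_div_iff₀ hρ]
  rw [pow_one] at h1
  linarith

/-- Calderon-type reproducing pair. -/
lemma exists_pair {n : ℕ} {ε : ℝ} (hε : 0 < ε) (Ψ ψ : Sch n)
    (hΨ : ∀ x : Rn n, ‖x‖ < 2 * ε → 0 < ‖Ψ x‖)
    (hψ : ∀ x : Rn n, ε / 2 < ‖x‖ → ‖x‖ < 2 * ε → 0 < ‖ψ x‖) :
    ∃ χ A B : Sch n, (∀ x, ‖x‖ < 6 / 5 * ε → χ x = 1) ∧ (∀ x, ‖x‖ < 3 / 5 * ε → B x = 0) ∧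
      ∀ J x, ∑ i ∈ Finset.range (J + 1), sys A B i x * sys Ψ ψ i x = dilate χ ((2 : ℝ) ^ J)⁻¹ x := by
  obtain ⟨χ, h1, h2⟩ := exists_bump n (r := 6 / 5 * ε) (R := 9 / 5 * ε) (by positivity) (by linarith)
  have K1 : IsCompact (closedBall (0 : Rn n) (9 / 5 * ε)) := isCompact_closedBall _ _
  obtain ⟨A, hA, _⟩ := exists_div χ Ψ K1 (fun x hx => h2 x (by simp at hx; exact hx.le))
    (fun x hx => norm_pos_iff.1 (hΨ x (by simp at hx; linarith)))
  have K2 : IsCompact (closedBall (0 : Rn n) (9 / 5 * ε) ∩ {x | 3 / 5 * ε ≤ ‖x‖}) :=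
    K1.inter_right (isClosed_le continuous_const continuous_norm)
  have hθ : ∀ x, (χ - dilate χ 2) x = χ x - χ ((2 : ℝ) • x) := fun x => by
    rw [sub_apply, dilate_apply _ two_ne_zero]
  have hn : ∀ x : Rn n, ‖(2 : ℝ) • x‖ = 2 * ‖x‖ := fun x => by rw [norm_smul, Real.norm_ofNat]
  have v1 : ∀ x, ‖x‖ < 3 / 5 * ε → (χ - dilate χ 2) x = 0 := fun x hx => by
    rw [hθ, h1 x (by linarith), h1 _ (by rw [hn]; linarith), sub_self]
  obtain ⟨B, hB, hB'⟩ := exists_div (χ - dilate χ 2) ψ K2 (fun x hx => by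
      by_cases h : ‖x‖ < 3 / 5 * ε
      · exact v1 x h
      · push Not at h
        have : 9 / 5 * ε < ‖x‖ := by
          by_contra h'
          exact hx ⟨by simpa using h', h⟩
        rw [hθ, h2 x this.le, h2 _ (by rw [hn]; linarith), sub_self])
    (fun x hx => norm_pos_iff.1 (hψ x (by have := hx.2; simp at this; linarith) (by have := hx.1; simp at this; linarith)))
  refine ⟨χ, A, B, fun x hx => h1 x hx.le, fun x hx => hB' x (v1 x hx), fun J x => ?_⟩
  induction J with
  | zero =>
    simp [sys, hA, dil_one]
  | succ J ih =>
    rw [Finset.sum_range_succ, ih]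
    unfold sys
    rw [if_neg (by omega), if_neg (by omega), dilate_apply _ (by positivity), dilate_apply _ (by positivity),
      dilate_apply _ (by positivity), dilate_apply _ (by positivity), hB, hθ, smul_smul]
    have : (2 : ℝ) * (2 ^ (J + 1))⁻¹ = (2 ^ J)⁻¹ := by rw [pow_succ]; field_simp
    rw [this]; ring

end Aux

namespace Aux

lemma rem_apply {n : ℕ} (b : Sch n) (m a : ℕ → Sch n) (J : ℕ) (x : Rn n) :
    (b - ∑ i ∈ Finset.range J, mulS (m i) (a i)) x = b x - ∑ i ∈ Finset.range J, m i x * a i x := by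
  have : (∑ i ∈ Finset.range J, mulS (m i) (a i)) x = ∑ i ∈ Finset.range J, m i x * a i x := by
    induction J with
    | zero => simp
    | succ J ih => rw [Finset.sum_range_succ, Finset.sum_range_succ, ← ih, ← mulS_apply]; rfl
  rw [← this]; rfl

/-- coefficients of the self-expansion -/
def mU1 {n : ℕ} (χ A B Ψ ψ : Sch n) (k i : ℕ) : Sch n :=
  if i < k then 0 else if i = k then dilate χ ((2 : ℝ) ^ k)⁻¹ else mulS (sys Ψ ψ k) (sys A B i)

lemma dil_zero {n : ℕ} (t : ℝ) : dilate (0 : Sch n) t = 0 := by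
  by_cases h : t = 0
  · unfold dilate; rw [dif_pos h]
  · ext x; rw [dilate_apply _ h]; rfl

lemma Q_zero {n : ℕ} (N : ℕ) : Q N (0 : Sch n) = 0 := map_zero _

lemma U1 {n : ℕ} {χ A B Ψ ψ : Sch n} {ρ ρ' : ℝ} (hρ : 0 < ρ) (hρ' : 0 < ρ') (h1 : ∀ x, ‖x‖ < ρ → χ x = 1)
    (h2 : ∀ x, ‖x‖ < ρ' → B x = 0)
    (h3 : ∀ J x, ∑ i ∈ Finset.range (J + 1), sys A B i x * sys Ψ ψ i x = dilate χ ((2 : ℝ) ^ J)⁻¹ x) (T : ℝ) :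
    Expd T (sys Ψ ψ) (sys Ψ ψ) (mU1 χ A B Ψ ψ) := by
  refine ⟨fun k N => ?_, fun N P => ?_, fun N => ⟨0, fun i d hd => ?_⟩⟩
  · refine conv_gen (g := sys Ψ ψ k) hρ h1 _ k (fun J hJ x => ?_) N
    rw [rem_apply]
    have : ∑ i ∈ Finset.range (J + 1), mU1 χ A B Ψ ψ k i x * sys Ψ ψ i x
        = sys Ψ ψ k x * dilate χ ((2 : ℝ) ^ J)⁻¹ x := by
      induction J, hJ using Nat.le_induction with
      | base =>
        rw [Finset.sum_range_succ, Finset.sum_eq_zero]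
        · simp [mU1, mul_comm]
        · intro i hi
          simp [mU1, Finset.mem_range.1 hi]
      | succ J hJ ih =>
        rw [Finset.sum_range_succ, ih, ← h3 (J + 1), Finset.sum_range_succ _ (J + 1), h3]
        unfold mU1
        rw [if_neg (by omega), if_neg (by omega), mulS_apply]
        ring
    rw [this]; ring
  · obtain ⟨C, hC0, hC⟩ := high_gen (b := sys Ψ ψ) (A := A) hρ' h2 (sys_self_Q Ψ ψ) N P
    have hq := Q_nonneg N χ
    refine ⟨C + Q N χ, fun k d => ?_⟩
    unfold mU1
    rw [if_neg (by omega)]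
    split_ifs with h
    · have : d = 0 := by omega
      subst this
      rw [dil_dil _ (by positivity) (by positivity), inv_mul_cancel₀ (by positivity), dil_one]
      simp [hC0]
    · exact (hC k d).trans (mul_le_mul_of_nonneg_right (by linarith) (by positivity))
  · unfold mU1
    rw [if_pos (by omega), dil_zero, Q_zero]; simp

/-- U3-type low bound -/
lemma res_low {n : ℕ} {φ : ℕ → Sch n} (hφ : SmoothResolution n φ) {k : ℕ} (hk : 0 < k) {x : Rn n}
    (hx : ‖x‖ < 2 ^ k / 2) : φ k x = 0 := by
  by_contra h
  have := (hφ.suppj k hk h).1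
  rw [Real.rpow_sub_one (by norm_num), Real.rpow_natCast] at this
  linarith

lemma res_up {n : ℕ} {φ : ℕ → Sch n} (hφ : SmoothResolution n φ) {k : ℕ} {x : Rn n}
    (hx : 2 * 2 ^ k < ‖x‖) : φ k x = 0 := by
  by_contra h
  rcases Nat.eq_zero_or_pos k with rfl | hk
  · have := hφ.supp0 h
    simp at this hx
    linarith
  · have := (hφ.suppj k hk h).2
    rw [Real.rpow_add_one (by norm_num), Real.rpow_natCast] at this
    linarith

lemma res_self {n : ℕ} {φ : ℕ → Sch n} (hφ : SmoothResolution n φ) :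
    ∃ G : ℕ → ℝ, ∀ N k, Q N (dilate (φ k) (2 ^ k)) ≤ G N := by
  choose C hC0 hC using res_bound hφ
  refine ⟨fun N => 2 ^ N * ∑ l ∈ Finset.range (N + 1), C l, fun N k => ?_⟩
  have hs : 0 ≤ ∑ l ∈ Finset.range (N + 1), C l := Finset.sum_nonneg fun l _ => hC0 l
  refine Q_le (by positivity) fun j hj l hl x => ?_
  by_cases hx : 2 < ‖x‖
  · have : (dilate (φ k) (2 ^ k) : Rn n → ℂ) =ᶠ[𝓝 x] fun _ => 0 := by
      have : {y : Rn n | 2 < ‖y‖} ∈ 𝓝 x := (isOpen_lt continuous_const continuous_norm).mem_nhds hx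
      filter_upwards [this] with y hy
      rw [dilate_apply _ (by positivity)]
      refine res_up hφ ?_
      rw [norm_smul, norm_pow, Real.norm_ofNat, mul_comm]
      exact mul_lt_mul_of_pos_left hy (by positivity)
    rw [(this.iteratedFDeriv ℝ l).self_of_nhds]
    have : iteratedFDeriv ℝ l (fun _ : Rn n => (0 : ℂ)) x = 0 := by
      rw [iteratedFDeriv_fun_zero]; rfl
    rw [this]; simpa using (by positivity)
  · push Not at hx
    have h1 : ‖iteratedFDeriv ℝ l (dilate (φ k) (2 ^ k)) x‖ ≤ C l := by
      rw [dil_D _ (by positivity), abs_of_pos (by positivity)]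
      have := mul_le_mul_of_nonneg_left (hC l k ((2 : ℝ) ^ k • x)) (by positivity : (0 : ℝ) ≤ (2 ^ k) ^ l)
      refine this.trans (le_of_eq ?_)
      field_simp
    have h2 : C l ≤ ∑ l ∈ Finset.range (N + 1), C l :=
      Finset.single_le_sum (f := C) (fun l _ => hC0 l) (Finset.mem_range.2 (by omega))
    have h3 : ‖x‖ ^ j ≤ 2 ^ N := (pow_le_pow_left₀ (norm_nonneg _) hx j).trans (pow_le_pow_right₀ (by norm_num) hj)
    exact mul_le_mul h3 (h1.trans h2) (norm_nonneg _) (by positivity)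

lemma res_temp {n : ℕ} {φ : ℕ → Sch n} (hφ : SmoothResolution n φ) (N : ℕ) :
    ∃ (C : ℝ) (P : ℕ), ∀ l, Q N (φ l) ≤ C * (2 ^ l) ^ P := by
  obtain ⟨G, hG⟩ := res_self hφ
  refine ⟨G N, N, fun l => ?_⟩
  have h := Q_dil N (dilate (φ l) (2 ^ l)) (t := 2 ^ l) (one_le_pow₀ (by norm_num))
  rw [dil_dil _ (by positivity) (by positivity), mul_inv_cancel₀ (by positivity), dil_one] at h
  refine h.trans ?_
  rw [mul_comm]
  exact mul_le_mul_of_nonneg_right (hG N l) (by positivity)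

lemma U3 {n : ℕ} {χ A B Ψ ψ : Sch n} {ρ ρ' : ℝ} (hρ : 0 < ρ) (hρ' : 0 < ρ') (h1 : ∀ x, ‖x‖ < ρ → χ x = 1)
    (h2 : ∀ x, ‖x‖ < ρ' → B x = 0)
    (h3 : ∀ J x, ∑ i ∈ Finset.range (J + 1), sys A B i x * sys Ψ ψ i x = dilate χ ((2 : ℝ) ^ J)⁻¹ x)
    {φ : ℕ → Sch n} (hφ : SmoothResolution n φ) (P : ℕ) :
    Expd P (sys Ψ ψ) φ (fun k i => mulS (φ k) (sys A B i)) := by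
  obtain ⟨G, hG⟩ := res_self hφ
  refine ⟨fun k N => ?_, fun N P => ?_, fun N => ?_⟩
  · refine conv_gen (g := φ k) hρ h1 _ 0 (fun J hJ x => ?_) N
    rw [rem_apply, ← h3, mul_sub, mul_one, Finset.mul_sum]
    congr 1
    refine Finset.sum_congr rfl fun i _ => ?_
    rw [mulS_apply, mul_assoc]
  · obtain ⟨C, hC0, hC⟩ := high_gen (b := φ) (A := A) hρ' h2 hG N P
    exact ⟨C, hC⟩
  · choose C hC0 hC using res_bound hφ
    have hs : 0 ≤ ∑ l ∈ Finset.range (N + 1), C l := Finset.sum_nonneg fun l _ => hC0 l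
    refine ⟨2 ^ N * (∑ l ∈ Finset.range (N + 1), C l) * (Q (N + P) A + Q (N + P) B) * 2 ^ P, fun i d hd => ?_⟩
    have h4 := lemD (N := N) (P := P) (B := ∑ l ∈ Finset.range (N + 1), C l) (R := 2 ^ d / 2)
      (r := dilate (mulS (φ (i + d)) (sys A B i)) (2 ^ i)) (g := dilate (sys A B i) (2 ^ i))
      (σ := dilate (φ (i + d)) (2 ^ i)) (fun x => by
        rw [dil_mulS _ _ (by positivity), mulS_apply, mul_comm]) (dilate (φ (i + d)) (2 ^ i)).smooth' hs
      (fun l hl x => by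
        rw [dil_D _ (by positivity), abs_of_pos (by positivity)]
        have h2 : C l ≤ ∑ l ∈ Finset.range (N + 1), C l :=
          Finset.single_le_sum (f := C) (fun l _ => hC0 l) (Finset.mem_range.2 (by omega))
        refine le_trans ?_ h2
        have := mul_le_mul_of_nonneg_left (hC l (i + d) ((2 : ℝ) ^ i • x)) (by positivity : (0 : ℝ) ≤ (2 ^ i) ^ l)
        refine this.trans ?_
        have e : (2 ^ i) ^ l * (C l * (((2 : ℝ) ^ (i + d)) ^ l)⁻¹) = C l * ((2 ^ d) ^ l)⁻¹ := by
          rw [pow_add, mul_pow]; field_simp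
        rw [e]
        refine mul_le_of_le_one_right (hC0 l) (inv_le_one_of_one_le₀ (one_le_pow₀ (one_le_pow₀ (by norm_num)))))
      (by positivity) (fun x hx => by
        rw [dilate_apply _ (by positivity)]
        refine res_low hφ (by omega) ?_
        rw [norm_smul, norm_pow, Real.norm_ofNat, pow_add, mul_div_assoc]
        exact mul_lt_mul_of_pos_left hx (by positivity))
    have h5 := h4.trans (mul_le_mul_of_nonneg_left (sys_self_Q A B (N + P) i) (by positivity))
    rw [Real.rpow_neg (by norm_num), Real.rpow_mul (by norm_num), Real.rpow_natCast, Real.rpow_natCast,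
      ← div_eq_mul_inv, le_div_iff₀ (by positivity)]
    rw [div_pow, div_mul_eq_mul_div, div_le_iff₀ (by positivity)] at h5
    linarith

lemma U2 {n : ℕ} {κ : Sch n} (h1 : ∀ x, ‖x‖ ≤ 2 → κ x = 1)
    {φ : ℕ → Sch n} (hφ : SmoothResolution n φ) (T : ℝ) :
    Expd T φ φ (fun k i => if i = k then dilate κ ((2 : ℝ) ^ k)⁻¹ else 0) := by
  refine ⟨fun k N => ?_, fun N P => ?_, fun N => ⟨0, fun i d hd => ?_⟩⟩
  · refine tendsto_const_nhds.congr' ?_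
    filter_upwards [eventually_gt_atTop k] with J hJ
    have : φ k - ∑ i ∈ Finset.range J, mulS (if i = k then dilate κ ((2 : ℝ) ^ k)⁻¹ else 0) (φ i) = 0 := by
      ext x
      rw [rem_apply, Finset.sum_eq_single k]
      · rw [if_pos rfl, dilate_apply _ (by positivity)]
        by_cases hx : 2 * 2 ^ k < ‖x‖
        · rw [res_up hφ hx]; simp
        · push Not at hx
          rw [h1]
          · simp
          · rw [norm_smul, norm_inv, norm_pow, Real.norm_ofNat]
            rwa [inv_mul_le_iff₀ (by positivity), mul_comm]
      · intro i _ hi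
        simp [hi]
      · intro h; exact absurd (Finset.mem_range.2 hJ) h
    rw [this, Q_zero]
  · refine ⟨Q N κ, fun k d => ?_⟩
    split_ifs with h
    · have : d = 0 := by omega
      subst this
      rw [dil_dil _ (by positivity) (by positivity), inv_mul_cancel₀ (by positivity), dil_one]
      simp
    · rw [dil_zero, Q_zero]
      have := Q_nonneg N κ
      positivity
  · rw [if_neg (by omega), dil_zero, Q_zero]; simp

end Aux

namespace Aux

lemma convR {n : ℕ} {φ : ℕ → Sch n} (hφ : SmoothResolution n φ) {g : Sch n} (r : ℕ → Sch n)
    (hr : ∀ J x, r J x = g x * (1 - ∑ i ∈ Finset.range J, φ i x)) (N : ℕ) :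
    Tendsto (fun J => Q N (r J)) atTop (𝓝 0) := by
  choose C hC0 hC using res_bound hφ
  have hs : 0 ≤ ∑ l ∈ Finset.range (N + 1), C l := Finset.sum_nonneg fun l _ => hC0 l
  have hb : ∀ l ≤ N, ∀ i x, ‖iteratedFDeriv ℝ l (φ i) x‖ ≤ ∑ l ∈ Finset.range (N + 1), C l := fun l hl i x => by
    have h2 : C l ≤ ∑ l ∈ Finset.range (N + 1), C l :=
      Finset.single_le_sum (f := C) (fun l _ => hC0 l) (Finset.mem_range.2 (by omega))
    refine (hC l i x).trans (le_trans ?_ h2)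
    exact mul_le_of_le_one_right (hC0 l) (inv_le_one_of_one_le₀ (one_le_pow₀ (one_le_pow₀ (by norm_num))))
  set D := ∑ l ∈ Finset.range (N + 1), C l with hD
  have hg := Q_nonneg (N + 2) g
  refine tend_of (K := 2 ^ N * (1 + D) * 2 * Q (N + 2) g) (J0 := 0) (fun _ => Q_nonneg _ _) fun J hJ => ?_
  have hsm : ∀ J, ContDiff ℝ ((⊤ : ℕ∞) : WithTop ℕ∞) (fun x : Rn n => 1 - ∑ i ∈ Finset.range J, φ i x) := fun J =>
    contDiff_const.sub (ContDiff.sum fun i _ => (φ i).smooth')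
  have hd : ∀ J, ∀ l ≤ N, ∀ x, ‖iteratedFDeriv ℝ l (fun x : Rn n => 1 - ∑ i ∈ Finset.range J, φ i x) x‖
      ≤ 1 + J * D := by
    intro J l hl x
    induction J with
    | zero => simpa using const_D l x
    | succ J ih =>
      have e0 : (fun x : Rn n => 1 - ∑ i ∈ Finset.range (J + 1), φ i x)
          = (fun x : Rn n => 1 - ∑ i ∈ Finset.range J, φ i x) - (φ J : Rn n → ℂ) := by
        ext x; rw [Finset.sum_range_succ]; simp only [Pi.sub_apply]; ring
      have e : iteratedFDeriv ℝ l (fun x : Rn n => 1 - ∑ i ∈ Finset.range (J + 1), φ i x) x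
        = iteratedFDeriv ℝ l (fun x : Rn n => 1 - ∑ i ∈ Finset.range J, φ i x) x - iteratedFDeriv ℝ l (φ J) x := by
        rw [e0]
        exact iteratedFDeriv_sub_apply (f := fun x : Rn n => 1 - ∑ i ∈ Finset.range J, φ i x) (g := φ J)
          ((hsm J).of_le (by exact_mod_cast le_top)).contDiffAt ((φ J).smooth l).contDiffAt
      rw [e]
      refine (norm_sub_le _ _).trans ((add_le_add ih (hb l hl J x)).trans ?_)
      push_cast; linarith
  have h1 := lemD (N := N) (P := 2) (B := 1 + ((J + 1 : ℕ) : ℝ) * D) (R := 2 ^ J) (hr (J + 1)) (hsm _) (by positivity)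
    (hd (J + 1)) (by positivity) (fun x hx => by
      rw [sub_eq_zero, ← hφ.sum_eq x]
      refine tsum_eq_sum fun i hi => ?_
      have hi : J + 1 ≤ i := by simpa using hi
      refine res_low hφ (by omega) (hx.trans_le ?_)
      rw [le_div_iff₀ (by norm_num), ← pow_succ]
      exact pow_le_pow_right₀ (by norm_num) hi)
  have h2 : ((J : ℝ) + 1) ≤ 2 ^ J := by exact_mod_cast Nat.lt_two_pow_self
  have h3 : (1 : ℝ) ≤ 2 ^ J := one_le_pow₀ (by norm_num)
  have h4 : 1 + ((J + 1 : ℕ) : ℝ) * D ≤ (1 + D) * 2 * 2 ^ J := by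
    push_cast
    nlinarith
  have h5 := h1.trans (mul_le_mul_of_nonneg_right (mul_le_mul_of_nonneg_left h4 (by positivity)) hg)
  have h6 : (0 : ℝ) < 2 ^ J := by positivity
  refine le_of_mul_le_mul_left ?_ h6
  calc _ = (2 ^ J) ^ 2 * Q N (r (J + 1)) := by ring
    _ ≤ _ := h5
    _ = _ := by ring

lemma U4 {n : ℕ} {Ψ ψ κ₀ κ : Sch n} {ρ : ℝ} (hρ : 0 < ρ) (h2 : ∀ x, ‖x‖ < ρ → κ x = 0)
    (h3 : ∀ x, 3 < ‖x‖ → κ₀ x = 0) (h3' : ∀ x, 3 < ‖x‖ → κ x = 0)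
    {φ : ℕ → Sch n} (hφ : SmoothResolution n φ) (h1 : ∀ i x, sys κ₀ κ i x * φ i x = φ i x) (T : ℕ)
    (hT : ∀ l < T, iteratedFDeriv ℝ l ψ 0 = 0) :
    Expd T φ (sys Ψ ψ) (fun k i => mulS (sys Ψ ψ k) (sys κ₀ κ i)) := by
  refine ⟨fun k N => ?_, fun N P => ?_, fun N => ?_⟩
  · refine convR hφ (g := sys Ψ ψ k) _ (fun J x => ?_) N
    rw [rem_apply, mul_sub, mul_one, Finset.mul_sum]
    congr 1
    refine Finset.sum_congr rfl fun i _ => ?_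
    rw [mulS_apply, mul_assoc, h1]
  · obtain ⟨C, hC0, hC⟩ := high_gen (b := sys Ψ ψ) (A := κ₀) hρ h2 (sys_self_Q Ψ ψ) N P
    exact ⟨C, hC⟩
  · have hfl : ∀ l, ∃ C : ℝ, 0 ≤ C ∧ ∀ (d : ℕ) (x : Rn n), ‖x‖ ≤ 3 →
        ‖iteratedFDeriv ℝ l (dilate ψ ((2 : ℝ) ^ d)⁻¹) x‖ ≤ C * ((2 ^ d) ^ T)⁻¹ := by
      intro l
      by_cases hl : l ≤ T
      · obtain ⟨C, hC0, hC⟩ := flat ψ T hT (T - l) (by omega)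
        have e : T - (T - l) = l := by omega
        rw [e] at hC
        refine ⟨C * 3 ^ (T - l), by positivity, fun d x hx => ?_⟩
        rw [dil_D _ (by positivity), abs_of_pos (by positivity)]
        have h5 : ‖((2 : ℝ) ^ d)⁻¹ • x‖ ≤ ((2 : ℝ) ^ d)⁻¹ * 3 := by
          rw [norm_smul, norm_inv, norm_pow, Real.norm_ofNat]
          exact mul_le_mul_of_nonneg_left hx (by positivity)
        calc _ ≤ ((2 : ℝ) ^ d)⁻¹ ^ l * (C * (((2 : ℝ) ^ d)⁻¹ * 3) ^ (T - l)) :=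
              mul_le_mul_of_nonneg_left ((hC _).trans (mul_le_mul_of_nonneg_left
                (pow_le_pow_left₀ (norm_nonneg _) h5 _) hC0)) (by positivity)
          _ = C * 3 ^ (T - l) * (((2 : ℝ) ^ d)⁻¹ ^ l * ((2 : ℝ) ^ d)⁻¹ ^ (T - l)) := by rw [mul_pow]; ring
          _ = _ := by rw [← pow_add, show l + (T - l) = T by omega, inv_pow]
      · push Not at hl
        refine ⟨Q l ψ, Q_nonneg _ _, fun d x hx => ?_⟩
        rw [dil_D _ (by positivity), abs_of_pos (by positivity), mul_comm]
        have h6 := le_Q (Nat.zero_le l) (le_refl l) ψ (((2 : ℝ) ^ d)⁻¹ • x)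
        rw [pow_zero, one_mul] at h6
        refine mul_le_mul h6 ?_ (by positivity) (Q_nonneg _ _)
        rw [inv_pow]
        exact inv_anti₀ (by positivity) (pow_le_pow_right₀ (one_le_pow₀ (by norm_num)) hl.le)
    choose C hC0 hC using hfl
    have hs : 0 ≤ ∑ l ∈ Finset.range (N + 1), C l := Finset.sum_nonneg fun l _ => hC0 l
    refine ⟨2 ^ N * (∑ l ∈ Finset.range (N + 1), C l) * (Q N κ₀ + Q N κ), fun i d hd => ?_⟩
    have h4 := lemF (N := N) (B := (∑ l ∈ Finset.range (N + 1), C l) * ((2 ^ d) ^ T)⁻¹) (R := 3)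
      (r := dilate (mulS (sys Ψ ψ (i + d)) (sys κ₀ κ i)) (2 ^ i)) (g := dilate (sys κ₀ κ i) (2 ^ i))
      (σ := dilate ψ ((2 : ℝ) ^ d)⁻¹) (fun x => by
        rw [dil_mulS _ _ (by positivity), mulS_apply, mul_comm, sys_dil _ _ _ _ hd]) (by positivity)
      (fun x hx => by
        rw [sys_dil_self]; split_ifs
        · exact h3 x hx
        · exact h3' x hx)
      (fun l hl x hx => (hC l d x hx).trans (mul_le_mul_of_nonneg_right
        (Finset.single_le_sum (f := C) (fun l _ => hC0 l) (Finset.mem_range.2 (by omega))) (by positivity)))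
    have h5 := h4.trans (mul_le_mul_of_nonneg_left (sys_self_Q κ₀ κ N i) (by positivity))
    rw [Real.rpow_neg (by norm_num), Real.rpow_mul (by norm_num), Real.rpow_natCast, Real.rpow_natCast]
    linarith

lemma exists_kappa {n : ℕ} {φ : ℕ → Sch n} (hφ : SmoothResolution n φ) : ∃ κ₀ κ : Sch n,
    (∀ x, ‖x‖ ≤ 2 → κ₀ x = 1) ∧ (∀ x, ‖x‖ < 1 / 4 → κ x = 0) ∧ (∀ x, 3 < ‖x‖ → κ₀ x = 0) ∧
    (∀ x, 3 < ‖x‖ → κ x = 0) ∧ (∀ i x, sys κ₀ κ i x * φ i x = φ i x) := by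
  obtain ⟨κ₀, h1, h2⟩ := exists_bump n (r := 2) (R := 3) (by norm_num) (by norm_num)
  have hθ : ∀ x, (κ₀ - dilate κ₀ 8) x = κ₀ x - κ₀ ((8 : ℝ) • x) := fun x => by
    rw [sub_apply, dilate_apply _ (by norm_num)]
  have hn : ∀ x : Rn n, ‖(8 : ℝ) • x‖ = 8 * ‖x‖ := fun x => by rw [norm_smul, Real.norm_ofNat]
  refine ⟨κ₀, κ₀ - dilate κ₀ 8, h1, fun x hx => ?_, fun x hx => h2 x hx.le, fun x hx => ?_, fun i x => ?_⟩
  · rw [hθ, h1 x (by linarith), h1 _ (by rw [hn]; linarith), sub_self]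
  · rw [hθ, h2 x (by linarith), h2 _ (by rw [hn]; linarith), sub_self]
  · by_cases hx : 2 * 2 ^ i < ‖x‖
    · rw [res_up hφ hx, mul_zero]
    push Not at hx
    unfold sys
    split_ifs with h
    · subst h
      rw [h1 x (by simpa using hx), one_mul]
    · by_cases hx' : ‖x‖ < 2 ^ i / 2
      · rw [res_low hφ (by omega) hx', mul_zero]
      · push Not at hx'
        have e : ‖((2 : ℝ) ^ i)⁻¹ • x‖ = ((2 : ℝ) ^ i)⁻¹ * ‖x‖ := by
          rw [norm_smul, norm_inv, norm_pow, Real.norm_ofNat]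
        have g1 : ((2 : ℝ) ^ i)⁻¹ * ‖x‖ ≤ 2 := by
          rwa [inv_mul_le_iff₀ (by positivity), mul_comm]
        have g2 : 1 / 2 ≤ ((2 : ℝ) ^ i)⁻¹ * ‖x‖ := by
          rw [le_inv_mul_iff₀ (by positivity)]; linarith
        rw [dilate_apply _ (by positivity), hθ, h1 _ (by rw [e]; exact g1), h2 _ (by rw [hn, e]; linarith),
          sub_zero, one_mul]

end Aux

namespace Aux

lemma lq_shift {q : ℝ≥0∞} (hq : 0 < q) (c : ℕ → ℝ≥0∞) :
    c 0 + lqSum q (fun j => c (j + 1)) ≤ 2 * lqSum q c := by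
  rw [two_mul]
  unfold lqSum
  split_ifs with h
  · exact add_le_add (le_iSup c 0) (iSup_le fun j => le_iSup c (j + 1))
  · have hr : 0 < q.toReal := ENNReal.toReal_pos hq.ne' h
    refine add_le_add ?_ ?_
    · calc c 0 = ((c 0) ^ q.toReal) ^ (1 / q.toReal) := by
            rw [← ENNReal.rpow_mul, mul_one_div_cancel hr.ne', ENNReal.rpow_one]
        _ ≤ _ := ENNReal.rpow_le_rpow (ENNReal.le_tsum (f := fun j => c j ^ q.toReal) 0) (by positivity)
    · refine ENNReal.rpow_le_rpow ?_ (by positivity)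
      rw [tsum_eq_zero_add' (f := fun j => c j ^ q.toReal) ENNReal.summable]
      exact le_add_self

lemma lq_unshift {q : ℝ≥0∞} (hq : 0 < q) : ∃ C : ℝ≥0∞, C ≠ ∞ ∧ ∀ c : ℕ → ℝ≥0∞,
    lqSum q c ≤ C * (c 0 + lqSum q (fun j => c (j + 1))) := by
  by_cases h : q = ∞
  · refine ⟨1, by simp, fun c => ?_⟩
    unfold lqSum
    rw [if_pos h, if_pos h, one_mul]
    refine iSup_le fun j => ?_
    cases j with
    | zero => exact le_self_add
    | succ j => exact (le_iSup (fun j => c (j + 1)) j).trans le_add_self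
  · have hr : 0 < q.toReal := ENNReal.toReal_pos hq.ne' h
    refine ⟨2 ^ (1 / q.toReal), ENNReal.rpow_ne_top_of_nonneg (by positivity) (by norm_num), fun c => ?_⟩
    have e : ∑' j, c j ^ q.toReal = c 0 ^ q.toReal + (lqSum q (fun j => c (j + 1))) ^ q.toReal := by
      rw [tsum_eq_zero_add' (f := fun j => c j ^ q.toReal) ENNReal.summable]
      unfold lqSum
      rw [if_neg h, ← ENNReal.rpow_mul, one_div_mul_cancel hr.ne', ENNReal.rpow_one]
    set X := c 0 + lqSum q (fun j => c (j + 1)) with hX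
    have h2 : ∑' j, c j ^ q.toReal ≤ 2 * X ^ q.toReal := by
      rw [e, two_mul]
      exact add_le_add (ENNReal.rpow_le_rpow le_self_add hr.le) (ENNReal.rpow_le_rpow le_add_self hr.le)
    have e2 : lqSum q c = (∑' j, c j ^ q.toReal) ^ (1 / q.toReal) := by
      unfold lqSum; rw [if_neg h]
    rw [e2]
    refine (ENNReal.rpow_le_rpow h2 (by positivity)).trans ?_
    rw [ENNReal.mul_rpow_of_nonneg _ _ (by positivity), ← ENNReal.rpow_mul, mul_one_div_cancel hr.ne',
      ENNReal.rpow_one]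

/-- the combined sequence norm -/
def psiN {n : ℕ} {E : Type*} [NormedAddCommGroup E] [NormedSpace ℂ E] (s : ℝ) (p q : ℝ≥0∞) (Ψ ψ : Sch n)
    (f : TDist n E) : ℝ≥0∞ :=
  lqSum q (fun k : ℕ => e2 (k * s) * eLpNorm (mOp (sys Ψ ψ k) f) p volume)

lemma besovPsi_eq {n : ℕ} {E : Type*} [NormedAddCommGroup E] [NormedSpace ℂ E] (s : ℝ) (p q : ℝ≥0∞) (Ψ ψ : Sch n)
    (f : TDist n E) : besovPsiNorm s p q Ψ ψ f =
      (fun k : ℕ => e2 (k * s) * eLpNorm (mOp (sys Ψ ψ k) f) p volume) 0 +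
      lqSum q (fun j => (fun k : ℕ => e2 (k * s) * eLpNorm (mOp (sys Ψ ψ k) f) p volume) (j + 1)) := by
  unfold besovPsiNorm
  congr 1
  · simp [sys, e2_zero]
  · congr 1
    ext j
    have : (2 : ℝ) ^ (-((j : ℝ) + 1)) = ((2 : ℝ) ^ (j + 1))⁻¹ := by
      rw [Real.rpow_neg (by norm_num)]
      congr 1
      exact_mod_cast Real.rpow_natCast 2 (j + 1)
    simp only [sys, this, e2, Nat.cast_add, Nat.cast_one]
    rw [if_neg (by omega)]

lemma both {n : ℕ} {E : Type*} [NormedAddCommGroup E] [NormedSpace ℂ E]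
    (s : ℝ) (p q : ℝ≥0∞) (hp : 0 < p) (hq : 0 < q)
    (S : ℤ) (hS : -1 ≤ S) (hSs : ⌊s⌋ ≤ S)
    (ε : ℝ) (hε : 0 < ε) (Ψ ψ : Sch n)
    (hΨ : ∀ x : Rn n, ‖x‖ < 2 * ε → 0 < ‖Ψ x‖)
    (hψ : ∀ x : Rn n, ε / 2 < ‖x‖ → ‖x‖ < 2 * ε → 0 < ‖ψ x‖)
    (hmom : ∀ α : Fin n → ℕ, (mdeg α : ℤ) ≤ S → mderiv α (fun y => ψ y) 0 = 0)
    (φ : ℕ → Sch n) (hφ : SmoothResolution n φ) :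
    ∃ C : ℝ≥0∞, C ≠ ∞ ∧ ∀ f : TDist n E, besovNorm s p q φ f ≤ C * besovPsiNorm s p q Ψ ψ f ∧
      besovPsiNorm s p q Ψ ψ f ≤ C * besovNorm s p q φ f := by
  obtain ⟨χ, A, B, c1, c2, c3⟩ := exists_pair hε Ψ ψ hΨ hψ
  obtain ⟨κ₀, κ, k1, k2, k3, k4, k5⟩ := exists_kappa hφ
  obtain ⟨P, hP⟩ := exists_nat_gt s
  have hT : s < ((S + 1).toNat : ℝ) := by
    have h1 : s < ⌊s⌋ + 1 := Int.lt_floor_add_one s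
    have h2 : ((⌊s⌋ : ℤ) : ℝ) ≤ (S : ℝ) := by exact_mod_cast hSs
    have h3 : (((S + 1).toNat : ℤ) : ℝ) = S + 1 := by
      rw [Int.toNat_of_nonneg (by omega)]; push_cast; ring
    have h4 : (((S + 1).toNat : ℤ) : ℝ) = ((S + 1).toNat : ℝ) := by norm_cast
    linarith
  obtain ⟨C1, hC1, H1⟩ := compare (E := E) hP hp hq (fun N => ⟨_, N, fun l => sys_temp Ψ ψ N l⟩)
    (U1 (by positivity) (by positivity) c1 c2 c3 0) (fun k i hi => by unfold mU1; rw [if_pos hi])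
    (U3 (by positivity) (by positivity) c1 c2 c3 hφ P)
  obtain ⟨C2, hC2, H2⟩ := compare (E := E) hT hp hq (res_temp hφ) (U2 k1 hφ 0) (fun k i hi => by rw [if_neg (by omega)])
    (U4 (Ψ := Ψ) (by norm_num) k2 k3 k4 hφ k5 (S + 1).toNat (mom_zero hmom))
  obtain ⟨C3, hC3, H3⟩ := lq_unshift hq
  refine ⟨C1 * C3 + 2 * C2, ?_, fun f => ⟨?_, ?_⟩⟩
  · exact ENNReal.add_ne_top.2 ⟨ENNReal.mul_ne_top hC1 hC3, ENNReal.mul_ne_top (by norm_num) hC2⟩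
  · refine (H1 f).trans ((mul_le_mul_right (H3 _) C1).trans ?_)
    rw [← mul_assoc, besovPsi_eq]
    exact mul_le_mul_left le_self_add _
  · rw [besovPsi_eq]
    refine (lq_shift hq (fun k : ℕ => e2 (k * s) * eLpNorm (mOp (sys Ψ ψ k) f) p volume)).trans
      ((mul_le_mul_right (H2 f) 2).trans ?_)
    rw [← mul_assoc]
    exact mul_le_mul_left le_add_self _

end Aux

/-- local-means type characterization of `B^s_{p,q}(E)` via `Ψ, ψ`
(Theorem of Bui–Paluszyński–Taibleson/Rychkov, Besov case, non-maximal version). -/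
theorem statement0 (n : ℕ) (E : Type*) [NormedAddCommGroup E] [NormedSpace ℂ E]
    [CompleteSpace E] (s : ℝ) (p q : ℝ≥0∞) (hp : 0 < p) (hq : 0 < q)
    (S : ℤ) (hS : -1 ≤ S) (hSs : ⌊s⌋ ≤ S)
    (ε : ℝ) (hε : 0 < ε) (Ψ ψ : Sch n)
    (hΨ : ∀ x : Rn n, ‖x‖ < 2 * ε → 0 < ‖Ψ x‖)
    (hψ : ∀ x : Rn n, ε / 2 < ‖x‖ → ‖x‖ < 2 * ε → 0 < ‖ψ x‖)
    (hmom : ∀ α : Fin n → ℕ, (mdeg α : ℤ) ≤ S → mderiv α (fun y => ψ y) 0 = 0)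
    (φ : ℕ → Sch n) (hφ : SmoothResolution n φ) :
    (∃ c₁ > (0 : ℝ), ∃ c₂ > (0 : ℝ), ∀ f : TDist n E, besovNorm s p q φ f < ∞ →
      ENNReal.ofReal c₁ * besovNorm s p q φ f ≤ besovPsiNorm s p q Ψ ψ f ∧
        besovPsiNorm s p q Ψ ψ f ≤ ENNReal.ofReal c₂ * besovNorm s p q φ f) ∧
    ∀ f : TDist n E, besovNorm s p q φ f < ∞ ↔ besovPsiNorm s p q Ψ ψ f < ∞ := by
  obtain ⟨C, hC, H⟩ := Aux.both (E := E) s p q hp hq S hS hSs ε hε Ψ ψ hΨ hψ hmom φ hφ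
  have hle : C ≤ ENNReal.ofReal (C.toReal + 1) := by
    rw [ENNReal.le_ofReal_iff_toReal_le hC (by positivity)]; linarith
  have hpos : 0 < C.toReal + 1 := by positivity
  refine ⟨⟨(C.toReal + 1)⁻¹, by positivity, C.toReal + 1, hpos, fun f _ => ⟨?_, ?_⟩⟩, fun f => ⟨fun h => ?_, fun h => ?_⟩⟩
  · rw [ENNReal.ofReal_inv_of_pos hpos]
    rw [mul_comm, ← div_eq_mul_inv]
    refine ENNReal.div_le_of_le_mul' ((H f).1.trans (mul_le_mul_left hle _))
  · exact (H f).2.trans (mul_le_mul_left hle _)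
  · exact (H f).2.trans_lt (ENNReal.mul_lt_top hC.lt_top h)
  · exact (H f).1.trans_lt (ENNReal.mul_lt_top hC.lt_top h)

end
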